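/- (Lower bound, zero-order Γ-limit of the edge energies) Let Ω ⊆ ℝ² be open, bounded, with Lipschitz boundary. Let ε_n ∈ (0,1) with ε_n → 0, let u_n : ℤ² → ℝ, and assume the restricted discrete vorticity measures μ_{u_n,ε_n}↾Ω converge flat to μ = Σ_{h=1}^N d_h δ_{x_h} ∈ X(Ω). Then there exists a constant C̄ ∈ ℝ such that for every σ > 0 with B_σ(x_h) ⊆ Ω for all h and B_σ(x_h) ∩ B_σ(x_{h'}) = ∅ for h ≠ h', and for every h ∈ {1,…,N}: liminf_{n→∞} ( F_{ε_n}^{edge}(u_n, B_σ(x_h)) − π|d_h|·log(σ/ε_n) ) ≥ C̄. In particular, liminf_{n→∞} (1/|log ε_n|)·F_{ε_n}^{edge}(u_n,Ω) ≥ π·|μ|(Ω). -/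

import Mathlib

open scoped Classical

open scoped ENNReal

/-- The plane `ℝ²` with the Euclidean norm. -/
abbrev Plane : Type := EuclideanSpace ℝ (Fin 2)

/-- The lattice point `i ∈ ℤ²` viewed as a point of the plane. -/
noncomputable def toPlane (i : ℤ × ℤ) : Plane :=
  (WithLp.equiv 2 (Fin 2 → ℝ)).symm ![(i.1 : ℝ), (i.2 : ℝ)]

/-- `Z_ε^{e}(A)`: the lattice points `i` such that the closed segment `[εi, ε(i+e)]`
is contained in `A`. -/
def latticeSeg (ε : ℝ) (e : ℤ × ℤ) (A : Set Plane) : Set (ℤ × ℤ) :=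
  {i | segment ℝ (ε • toPlane i) (ε • toPlane (i + e)) ⊆ A}

/-- The distance of a real number to the set of integers. -/
noncomputable def distZ (t : ℝ) : ℝ := ⨅ n : ℤ, |t - n|

/-- The distance of a real number to the set of half-integers `(1/2)ℤ`. -/
noncomputable def distHalfZ (t : ℝ) : ℝ := ⨅ n : ℤ, |t - n / 2|

/-- The interaction potential `f₀(t) = 2π²t²`. -/
noncomputable def f0 (t : ℝ) : ℝ := 2 * Real.pi ^ 2 * t ^ 2

/-- The interaction potential `f₁(t) = 2π²·dist(t,ℤ)²`. -/
noncomputable def f1 (t : ℝ) : ℝ := 2 * Real.pi ^ 2 * distZ t ^ 2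

/-- The interaction potential `f_{1/2}(t) = 2π²·dist(t,(1/2)ℤ)²`. -/
noncomputable def fHalf (t : ℝ) : ℝ := 2 * Real.pi ^ 2 * distHalfZ t ^ 2

/-- The edge-dislocation energy `F_ε^{edge}(u,A)`, a sum in `[0,∞]`. -/
noncomputable def Fedge (ε : ℝ) (u : ℤ × ℤ → ℝ) (A : Set Plane) : ℝ≥0∞ :=
  (∑' i : latticeSeg ε (1, 0) A, ENNReal.ofReal (f0 (u ((i : ℤ × ℤ) + (1, 0)) - u (i : ℤ × ℤ))))
    + ∑' i : latticeSeg ε (0, 1) A, ENNReal.ofReal (f1 (u ((i : ℤ × ℤ) + (0, 1)) - u (i : ℤ × ℤ)))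

/-- The screw-dislocation energy `F_ε^{screw}(u,A)`, a sum in `[0,∞]`. -/
noncomputable def Fscrew (ε : ℝ) (u : ℤ × ℤ → ℝ) (A : Set Plane) : ℝ≥0∞ :=
  (∑' i : latticeSeg ε (1, 0) A, ENNReal.ofReal (f1 (u ((i : ℤ × ℤ) + (1, 0)) - u (i : ℤ × ℤ))))
    + ∑' i : latticeSeg ε (0, 1) A, ENNReal.ofReal (f1 (u ((i : ℤ × ℤ) + (0, 1)) - u (i : ℤ × ℤ)))

/-- The partial-edge-dislocation energy `F_ε^{p-edge}(u,A)` (with parameter `α`),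
a sum in `[0,∞]`. -/
noncomputable def Fpedge (α ε : ℝ) (u : ℤ × ℤ → ℝ) (A : Set Plane) : ℝ≥0∞ :=
  (∑' i : latticeSeg ε (1, 0) A, ENNReal.ofReal (f0 (u ((i : ℤ × ℤ) + (1, 0)) - u (i : ℤ × ℤ))))
    + (∑' i : latticeSeg ε (0, 1) A,
        ENNReal.ofReal (fHalf (u ((i : ℤ × ℤ) + (0, 1)) - u (i : ℤ × ℤ))))
    + ENNReal.ofReal (α / Real.pi ^ 2 * ε) *
        ∑' i : latticeSeg ε (0, 2) A, ENNReal.ofReal (f1 (u ((i : ℤ × ℤ) + (0, 2)) - u (i : ℤ × ℤ)))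

/-- The elastic part `E(t) = t − ⌈t − 1/2⌉` of an increment `t`. -/
noncomputable def elast (t : ℝ) : ℝ := t - ⌈t - 1 / 2⌉

/-- The center `ε(i + (1/2,1/2))` of the lattice square with lower-left corner `εi`. -/
noncomputable def center (ε : ℝ) (i : ℤ × ℤ) : Plane :=
  (WithLp.equiv 2 (Fin 2 → ℝ)).symm ![ε * ((i.1 : ℝ) + 1 / 2), ε * ((i.2 : ℝ) + 1 / 2)]

/-- The circulation `m_u(i)` of the elastic increments of `u` around the square at `i`. -/
noncomputable def mCirc (u : ℤ × ℤ → ℝ) (i : ℤ × ℤ) : ℝ :=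
  elast (u (i + (1, 0)) - u i) + elast (u (i + (1, 1)) - u (i + (1, 0)))
    - elast (u (i + (1, 1)) - u (i + (0, 1))) - elast (u (i + (0, 1)) - u i)

/-- The discrete vorticity measure `μ_{u,ε}↾Ω`, viewed as a finitely supported real linear
combination of Dirac masses, encoded by its coefficient function: only squares whose center
`ε(i+(1/2,1/2))` lies in `Ω` are kept. -/
noncomputable def vortMeas (ε : ℝ) (u : ℤ × ℤ → ℝ) (Ω : Set Plane) : Plane → ℝ :=
  fun p => ∑ᶠ (i : ℤ × ℤ) (_ : center ε i = p ∧ center ε i ∈ Ω), mCirc u i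

/-- The flat norm (relative to `Ω`) of a finite real combination of Dirac masses encoded by its
coefficient function `m`:
`‖T‖_flat = sup{ Σ_x m(x)ψ(x) : ψ smooth, compactly supported in Ω, ‖ψ‖_∞ ≤ 1, ‖∇ψ‖_∞ ≤ 1}`. -/
noncomputable def flatNorm (Ω : Set Plane) (m : Plane → ℝ) : ℝ :=
  sSup {r : ℝ | ∃ ψ : Plane → ℝ, ContDiff ℝ (⊤ : ℕ∞) ψ ∧ HasCompactSupport ψ ∧ tsupport ψ ⊆ Ω ∧
    (∀ p, |ψ p| ≤ 1) ∧ (∀ p, ‖fderiv ℝ ψ p‖ ≤ 1) ∧ r = ∑ᶠ p, m p * ψ p}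

/-- `Ω ⊆ ℝ²` has Lipschitz boundary: near every boundary point, `Ω` coincides with the rotated
subgraph of a Lipschitz function `φ : ℝ → ℝ`. -/
def HasLipschitzBoundary (Ω : Set Plane) : Prop :=
  ∀ x ∈ frontier Ω, ∃ r : ℝ, 0 < r ∧ ∃ R : Plane ≃ₗᵢ[ℝ] Plane,
    LinearMap.det (R.toLinearEquiv : Plane →ₗ[ℝ] Plane) = 1 ∧
    ∃ K : NNReal, ∃ φ : ℝ → ℝ, LipschitzWith K φ ∧
      Ω ∩ Metric.ball x r
        = {p : Plane | ∃ y : Plane, p = x + R y ∧ y 1 < φ (y 0)} ∩ Metric.ball x r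

section Helpers

open MeasureTheory Metric

/-- Lower bound on vortex-free annuli. -/
def AnnProp {V : Type} (ν : Measure Plane) (U : Set Plane) (q : V → Plane) (ρ κ : ℝ)
    (m : V → ℝ) : Prop :=
  ∀ (c : Plane) (r R : ℝ), 0 < r → r ≤ R → ball c R ⊆ U → ∀ I : Finset V,
    (∀ p ∈ I, ball (q p) ρ ⊆ ball c r) → (∀ p, p ∉ I → Disjoint (ball (q p) ρ) (ball c R)) →
    κ * Real.log (R / r) * |∑ p ∈ I, m p| ≤ ν.real (ball c R \ ball c r)

/-- Outcome of the ball construction. -/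
def BallRes {V : Type} [Fintype V] (ν : Measure Plane) (U : Set Plane) (κ : ℝ) (m : V → ℝ)
    (J : Finset V) (c : V → Plane) (r : V → ℝ) (a : V → V) (t : ℝ) : Prop :=
  ∃ (J' : Finset V) (c' : V → Plane) (r' : V → ℝ) (f : V → V),
    (∀ j ∈ J, f j ∈ J') ∧ (∀ j ∈ J', 0 < r' j) ∧
    (∀ j ∈ J, ball (c j) (r j) ⊆ ball (c' (f j)) (r' (f j))) ∧
    (∑ j ∈ J', r' j ≤ Real.exp t * ∑ j ∈ J, r j) ∧
    (∀ i ∈ J', ∀ j ∈ J', i ≠ j → Disjoint (ball (c' i) (r' i)) (ball (c' j) (r' j))) ∧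
    (∀ j ∈ J', ball (c' j) (r' j) ⊆ U →
      κ * t * |∑ p with f (a p) = j, m p| ≤
        ν.real (ball (c' j) (r' j) \ ⋃ i ∈ J, ball (c i) (r i)))

lemma ballRes_base {V : Type} [Fintype V] (ν : Measure Plane) (U : Set Plane)
    (κ : ℝ) (m : V → ℝ)
    (J : Finset V) (c : V → Plane) (r : V → ℝ) (a : V → V) (hr : ∀ j ∈ J, 0 < r j)
    (hdis : ∀ i ∈ J, ∀ j ∈ J, i ≠ j → r i + r j ≤ dist (c i) (c j)) :
    BallRes ν U κ m J c r a 0 := by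
  refine ⟨J, c, r, id, fun j hj => hj, hr, fun j _ => subset_rfl, by simp, ?_, ?_⟩
  · intro i hi j hj hij
    exact ball_disjoint_ball (hdis i hi j hj hij)
  · intro j hj _
    simp

lemma ballRes_merge {V : Type} [Fintype V] (ν : Measure Plane) [IsFiniteMeasure ν] (U : Set Plane)
    (κ : ℝ) (m : V → ℝ)
    (J : Finset V) (c : V → Plane) (r : V → ℝ) (a : V → V) (t : ℝ)
    (J₁ : Finset V) (c₁ : V → Plane) (r₁ : V → ℝ) (g : V → V)
    (hg : ∀ j ∈ J, g j ∈ J₁)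
    (hb : ∀ j ∈ J, ball (c j) (r j) ⊆ ball (c₁ (g j)) (r₁ (g j)))
    (hs : ∑ j ∈ J₁, r₁ j ≤ ∑ j ∈ J, r j)
    (h : BallRes ν U κ m J₁ c₁ r₁ (g ∘ a) t) :
    BallRes ν U κ m J c r a t := by
  obtain ⟨J', c', r', f, h1, h2, h3, h4, h5, h6⟩ := h
  refine ⟨J', c', r', f ∘ g, fun j hj => h1 _ (hg j hj), h2,
    fun j hj => (hb j hj).trans (h3 _ (hg j hj)), h4.trans ?_, h5, ?_⟩
  · gcongr
  · intro j hj hU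
    refine (h6 j hj hU).trans ?_
    refine measureReal_mono ?_
    refine Set.sdiff_subset_sdiff_right ?_
    intro z hz
    simp only [Set.mem_iUnion] at hz ⊢
    obtain ⟨i, hi, hz⟩ := hz
    exact ⟨g i, hg i hi, hb i hi hz⟩

/-- merging two touching balls -/
lemma ballRes_merge2 {V : Type} [Fintype V] (ν : Measure Plane) [IsFiniteMeasure ν] (U : Set Plane)
    (κ : ℝ) (m : V → ℝ)
    (J : Finset V) (c : V → Plane) (r : V → ℝ) (a : V → V) (t : ℝ)
    (q : V → Plane) (ρ : ℝ) (hr : ∀ j ∈ J, 0 < r j) (ha : ∀ p, a p ∈ J)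
    (hq : ∀ p, ball (q p) ρ ⊆ ball (c (a p)) (r (a p)))
    (i j : V) (hi : i ∈ J) (hj : j ∈ J) (hij : i ≠ j) (hd : dist (c i) (c j) ≤ r i + r j)
    (IH : ∀ (J₁ : Finset V) (c₁ : V → Plane) (r₁ : V → ℝ) (a₁ : V → V), J₁.card < J.card →
      (∀ j ∈ J₁, 0 < r₁ j) → (∀ p, a₁ p ∈ J₁) →
      (∀ p, ball (q p) ρ ⊆ ball (c₁ (a₁ p)) (r₁ (a₁ p))) → BallRes ν U κ m J₁ c₁ r₁ a₁ t) :
    BallRes ν U κ m J c r a t := by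
  have hri := hr i hi
  have hrj := hr j hj
  set s := r i + r j with hs
  have hs0 : 0 < s := by positivity
  set z : Plane := c i + (r j / s) • (c j - c i) with hz
  have hd' : ‖c j - c i‖ ≤ s := by rw [← dist_eq_norm, dist_comm]; exact hd
  have hzi : dist (c i) z ≤ r j := by
    rw [dist_eq_norm, hz, show c i - (c i + (r j / s) • (c j - c i)) = -((r j / s) • (c j - c i)) by abel,
      norm_neg, norm_smul, Real.norm_of_nonneg (by positivity)]
    calc r j / s * ‖c j - c i‖ ≤ r j / s * s := by gcongr
      _ = r j := by field_simp
  have hzj : dist (c j) z ≤ r i := by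
    have : c j - z = (r i / s) • (c j - c i) := by
      have h1 : r i / s = 1 - r j / s := by field_simp; rw [hs]; ring
      rw [h1, hz, sub_smul, one_smul]; abel
    rw [dist_eq_norm, this, norm_smul, Real.norm_of_nonneg (by positivity)]
    calc r i / s * ‖c j - c i‖ ≤ r i / s * s := by gcongr
      _ = r i := by field_simp
  set g : V → V := fun k => if k = j then i else k with hg
  set c₁ := Function.update c i z
  set r₁ := Function.update r i s
  have hgJ : ∀ k ∈ J, g k ∈ J.erase j := by
    intro k hk
    simp only [hg]
    split_ifs with h
    · simp [hij, hi]
    · simp [h, hk]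
  have hb : ∀ k ∈ J, ball (c k) (r k) ⊆ ball (c₁ (g k)) (r₁ (g k)) := by
    intro k hk
    by_cases h : k = j
    · subst h
      simp only [hg, if_true, c₁, r₁, Function.update_self]
      refine ball_subset_ball' ?_
      rw [hs]; linarith
    · by_cases h' : k = i
      · subst h'
        simp only [hg, h, if_false, c₁, r₁, Function.update_self]
        refine ball_subset_ball' ?_
        rw [hs]; linarith
      · simp only [hg, h, if_false, c₁, r₁, Function.update_of_ne h']
        exact subset_rfl
  refine ballRes_merge ν U κ m J c r a t (J.erase j) c₁ r₁ g hgJ hb ?_ ?_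
  · have hi' : i ∈ J.erase j := by simp [hij, hi]
    rw [← Finset.add_sum_erase _ _ hj, ← Finset.add_sum_erase _ _ hi', ← Finset.add_sum_erase _ _ hi']
    have : ∑ x ∈ (J.erase j).erase i, r₁ x = ∑ x ∈ (J.erase j).erase i, r x := by
      refine Finset.sum_congr rfl fun x hx => ?_
      simp only [r₁]
      rw [Function.update_of_ne (Finset.ne_of_mem_erase hx)]
    rw [this]
    simp only [r₁, Function.update_self, hs]
    linarith
  · refine IH _ _ _ _ (Finset.card_erase_lt_of_mem hj) ?_ ?_ ?_
    · intro k hk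
      by_cases h' : k = i
      · subst h'; simpa only [r₁, Function.update_self] using hs0
      · simpa only [r₁, Function.update_of_ne h'] using hr k (Finset.mem_of_mem_erase hk)
    · intro p
      exact hgJ _ (ha p)
    · intro p
      exact (hq p).trans (hb _ (ha p))

lemma ballRes_expand {V : Type} [Fintype V] (ν : Measure Plane) [IsFiniteMeasure ν] (U : Set Plane)
    (κ : ℝ) (hκ : 0 ≤ κ) (m : V → ℝ)
    (J : Finset V) (c : V → Plane) (r : V → ℝ) (a : V → V) (t l : ℝ) (hl : 1 ≤ l)
    (q : V → Plane) (ρ : ℝ) (hr : ∀ j ∈ J, 0 < r j) (ha : ∀ p, a p ∈ J)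
    (hq : ∀ p, ball (q p) ρ ⊆ ball (c (a p)) (r (a p)))
    (hA : AnnProp ν U q ρ κ m)
    (hdis : ∀ i ∈ J, ∀ j ∈ J, i ≠ j → l * (r i + r j) ≤ dist (c i) (c j))
    (h : BallRes ν U κ m J c (fun j => l * r j) a (t - Real.log l)) :
    BallRes ν U κ m J c r a t := by
  have hl0 : 0 < l := by linarith
  obtain ⟨J', c', r', f, h1, h2, h3, h4, h5, h6⟩ := h
  have hsub : ∀ j ∈ J, ball (c j) (r j) ⊆ ball (c j) (l * r j) := fun j hj =>
    ball_subset_ball (by nlinarith [hr j hj])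
  have hD : ∀ i ∈ J, ∀ j ∈ J, i ≠ j → Disjoint (ball (c i) (l * r i)) (ball (c j) (l * r j)) := by
    intro i hi j hj hij
    refine ball_disjoint_ball ?_
    have := hdis i hi j hj hij
    linarith
  refine ⟨J', c', r', f, h1, h2, fun j hj => (hsub j hj).trans (h3 j hj), ?_, h5, ?_⟩
  · refine h4.trans (le_of_eq ?_)
    rw [Real.exp_sub, Real.exp_log hl0, ← Finset.mul_sum]
    field_simp
  · intro j hj hU
    have h7 := h6 j hj hU
    -- the annuli
    have hann : ∀ i ∈ J.filter (fun i => f i = j),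
        κ * Real.log l * |∑ p with a p = i, m p| ≤ ν.real (ball (c i) (l * r i) \ ball (c i) (r i)) := by
      intro i hi
      rw [Finset.mem_filter] at hi
      have hri := hr i hi.1
      have := hA (c i) (r i) (l * r i) hri (by nlinarith)
        ((h3 i hi.1).trans (by rw [hi.2]; exact hU)) (Finset.univ.filter (fun p => a p = i)) ?_ ?_
      · rwa [mul_div_assoc, div_self hri.ne', mul_one] at this
      · intro p hp
        simp only [Finset.mem_filter, Finset.mem_univ, true_and] at hp
        rw [← hp]; exact hq p
      · intro p hp
        simp only [Finset.mem_filter, Finset.mem_univ, true_and] at hp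
        exact (hD _ (ha p) _ hi.1 hp).mono_left ((hq p).trans (hsub _ (ha p)))
    have htri : |∑ p with f (a p) = j, m p| ≤ ∑ i ∈ J with f i = j, |∑ p with a p = i, m p| := by
      refine le_trans (le_of_eq ?_) (Finset.abs_sum_le_sum_abs _ _)
      congr 1
      rw [Finset.sum_filter, ← Finset.sum_fiberwise_of_maps_to (s := Finset.univ) (t := J) (g := a)
        (fun p _ => ha p), Finset.sum_filter]
      refine Finset.sum_congr rfl fun i _ => ?_
      split_ifs with hfi
      · refine Finset.sum_congr rfl fun p hp => ?_
        simp only [Finset.mem_filter, Finset.mem_univ, true_and] at hp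
        rw [hp, if_pos hfi]
      · refine Finset.sum_eq_zero fun p hp => ?_
        simp only [Finset.mem_filter, Finset.mem_univ, true_and] at hp
        rw [hp, if_neg hfi]
    set A := ball (c' j) (r' j) \ ⋃ i ∈ J, ball (c i) (l * r i)
    set B := ⋃ i ∈ J.filter (fun i => f i = j), (ball (c i) (l * r i) \ ball (c i) (r i))
    have hBm : MeasurableSet B := Finset.measurableSet_biUnion _ fun i _ =>
      measurableSet_ball.diff measurableSet_ball
    have hBν : ν.real B = ∑ i ∈ J with f i = j, ν.real (ball (c i) (l * r i) \ ball (c i) (r i)) := by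
      refine measureReal_biUnion_finset ?_ (fun i _ => measurableSet_ball.diff measurableSet_ball)
      intro i hi k hk hik
      simp only [Finset.coe_filter, Set.mem_ofPred_eq] at hi hk
      exact (hD i hi.1 k hk.1 hik).mono Set.sdiff_subset Set.sdiff_subset
    have hAB : Disjoint A B := by
      rw [Set.disjoint_left]
      intro z hz hzB
      simp only [A, B, Set.mem_sdiff, Set.mem_iUnion, Finset.mem_filter] at hz hzB
      obtain ⟨i, hi, hz'⟩ := hzB
      exact hz.2 ⟨i, hi.1, hz'.1⟩
    have hsubAB : A ∪ B ⊆ ball (c' j) (r' j) \ ⋃ i ∈ J, ball (c i) (r i) := by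
      rintro z (hz | hz)
      · refine ⟨hz.1, fun hz' => hz.2 ?_⟩
        simp only [Set.mem_iUnion] at hz' ⊢
        obtain ⟨i, hi, hz'⟩ := hz'
        exact ⟨i, hi, hsub i hi hz'⟩
      · simp only [B, Set.mem_iUnion, Finset.mem_filter] at hz
        obtain ⟨i, ⟨hi, hfi⟩, hz⟩ := hz
        refine ⟨by rw [← hfi]; exact h3 i hi hz.1, fun hz' => ?_⟩
        simp only [Set.mem_iUnion] at hz'
        obtain ⟨k, hk, hz'⟩ := hz'
        by_cases hik : i = k
        · subst hik; exact hz.2 hz'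
        · exact Set.disjoint_left.1 (hD i hi k hk hik) hz.1 (hsub k hk hz')
    have hlog : 0 ≤ Real.log l := Real.log_nonneg hl
    calc κ * t * |∑ p with f (a p) = j, m p|
        = κ * (t - Real.log l) * |∑ p with f (a p) = j, m p|
          + κ * Real.log l * |∑ p with f (a p) = j, m p| := by ring
      _ ≤ ν.real A + κ * Real.log l * ∑ i ∈ J with f i = j, |∑ p with a p = i, m p| := by
          gcongr
      _ ≤ ν.real A + ν.real B := by
          rw [hBν, Finset.mul_sum]
          gcongr with i hi
          exact hann i hi
      _ = ν.real (A ∪ B) := (measureReal_union hAB hBm (measure_ne_top _ _) (measure_ne_top _ _)).symm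
      _ ≤ _ := measureReal_mono hsubAB

theorem ball_construction {V : Type} [Fintype V] (ν : Measure Plane) [IsFiniteMeasure ν]
    (U : Set Plane) (κ : ℝ) (hκ : 0 ≤ κ) (m : V → ℝ) (q : V → Plane) (ρ : ℝ)
    (hA : AnnProp ν U q ρ κ m) :
    ∀ (n : ℕ) (J : Finset V) (c : V → Plane) (r : V → ℝ) (a : V → V) (t : ℝ), J.card = n →
      0 ≤ t → (∀ j ∈ J, 0 < r j) → (∀ p, a p ∈ J) →
      (∀ p, ball (q p) ρ ⊆ ball (c (a p)) (r (a p))) → BallRes ν U κ m J c r a t := by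
  intro n
  induction n using Nat.strong_induction_on with
  | _ n IH =>
  intro J c r a t hn ht hr ha hq
  by_cases hex : ∃ i ∈ J, ∃ j ∈ J, i ≠ j ∧ dist (c i) (c j) ≤ r i + r j
  · obtain ⟨i, hi, j, hj, hij, hd⟩ := hex
    refine ballRes_merge2 ν U κ m J c r a t q ρ hr ha hq i j hi hj hij hd ?_
    intro J₁ c₁ r₁ a₁ hc h1 h2 h3
    exact IH _ (hn ▸ hc) J₁ c₁ r₁ a₁ t rfl ht h1 h2 h3
  · push Not at hex
    by_cases hall : ∀ i ∈ J, ∀ j ∈ J, i ≠ j → Real.exp t * (r i + r j) ≤ dist (c i) (c j)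
    · refine ballRes_expand ν U κ hκ m J c r a t (Real.exp t) (Real.one_le_exp ht) q ρ hr ha hq hA
        hall ?_
      rw [Real.log_exp, sub_self]
      refine ballRes_base ν U κ m J c _ a (fun j hj => mul_pos (Real.exp_pos t) (hr j hj)) ?_
      intro i hi j hj hij
      rw [← mul_add]
      exact hall i hi j hj hij
    · push Not at hall
      obtain ⟨i₀, hi₀, j₀, hj₀, hij₀, hlt₀⟩ := hall
      set P : Finset (V × V) := (J ×ˢ J).filter (fun x => x.1 ≠ x.2)
      have hPne : P.Nonempty := ⟨(i₀, j₀), by simp [P, hi₀, hj₀, hij₀]⟩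
      obtain ⟨⟨i, j⟩, hP, hmin⟩ := Finset.exists_min_image P
        (fun x => dist (c x.1) (c x.2) / (r x.1 + r x.2)) hPne
      simp only [P, Finset.mem_filter, Finset.mem_product] at hP
      obtain ⟨⟨hi, hj⟩, hij⟩ := hP
      set l := dist (c i) (c j) / (r i + r j) with hl
      have hrij : 0 < r i + r j := add_pos (hr i hi) (hr j hj)
      have hl1 : 1 ≤ l := by
        rw [hl, le_div_iff₀ hrij, one_mul]
        exact (hex i hi j hj hij).le
      have hl0 : 0 < l := by linarith
      have hlt : l ≤ Real.exp t := by
        have := hmin (i₀, j₀) (by simp [P, hi₀, hj₀, hij₀])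
        refine this.trans ?_
        rw [div_le_iff₀ (add_pos (hr i₀ hi₀) (hr j₀ hj₀))]
        exact hlt₀.le
      refine ballRes_expand ν U κ hκ m J c r a t l hl1 q ρ hr ha hq hA ?_ ?_
      · intro x hx y hy hxy
        have := hmin (x, y) (by simp [P, hx, hy, hxy])
        rwa [le_div_iff₀ (add_pos (hr x hx) (hr y hy))] at this
      · refine ballRes_merge2 ν U κ m J c _ a _ q ρ (fun j hj => mul_pos hl0 (hr j hj)) ha ?_ i j
          hi hj hij ?_ ?_
        · intro p
          refine (hq p).trans (ball_subset_ball ?_)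
          nlinarith [hr _ (ha p)]
        · rw [← mul_add, hl]
          field_simp
          exact le_rfl
        · intro J₁ c₁ r₁ a₁ hc h1 h2 h3
          refine IH _ (hn ▸ hc) J₁ c₁ r₁ a₁ _ rfl ?_ h1 h2 h3
          rw [sub_nonneg]
          exact (Real.log_le_iff_le_exp hl0).2 hlt

/-- unit coordinate vector -/
noncomputable def ev (k : Fin 2) : Plane := EuclideanSpace.single k (1 : ℝ)

/-- truncated logarithm -/
noncomputable def wlog (c : Plane) (r R : ℝ) (z : Plane) : ℝ :=
  Real.log R - Real.log (max r (min ‖z - c‖ R))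

/-- gradient of the truncated logarithm -/
noncomputable def glog (c : Plane) (r R : ℝ) (k : Fin 2) (z : Plane) : ℝ :=
  if r < ‖z - c‖ ∧ ‖z - c‖ < R then -((z k - c k) / ‖z - c‖ ^ 2) else 0

lemma plane_norm_sq (z : Plane) : ‖z‖ ^ 2 = z 0 ^ 2 + z 1 ^ 2 := by
  rw [EuclideanSpace.norm_sq_eq, Fin.sum_univ_two]
  simp

lemma plane_abs_le (z : Plane) (k : Fin 2) : |z k| ≤ ‖z‖ := by
  have := PiLp.norm_apply_le z k
  simpa using this

lemma wlog_continuous (c : Plane) (r R : ℝ) (hr : 0 < r) : Continuous (wlog c r R) := by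
  unfold wlog
  refine continuous_const.sub (Continuous.log (by fun_prop) ?_)
  intro z
  exact (lt_of_lt_of_le hr (le_max_left _ _)).ne'

lemma glog_measurable (c : Plane) (r R : ℝ) (k : Fin 2) : Measurable (glog c r R k) := by
  unfold glog
  refine Measurable.ite ?_ ?_ measurable_const
  · have hm : Measurable (fun z : Plane => ‖z - c‖) := by fun_prop
    exact (measurableSet_lt measurable_const hm).inter (measurableSet_lt hm measurable_const)
  · fun_prop

lemma glog_bound (c : Plane) (r R : ℝ) (hr : 0 < r) (k : Fin 2) (z : Plane) :
    |glog c r R k z| ≤ 1 / r := by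
  unfold glog
  split_ifs with h
  · have h0 : 0 < ‖z - c‖ := hr.trans h.1
    have h1 : |z k - c k| ≤ ‖z - c‖ := by simpa using plane_abs_le (z - c) k
    rw [abs_neg, abs_div, abs_of_nonneg (by positivity : 0 ≤ ‖z - c‖ ^ 2)]
    calc |z k - c k| / ‖z - c‖ ^ 2 ≤ ‖z - c‖ / ‖z - c‖ ^ 2 := by gcongr
      _ = 1 / ‖z - c‖ := by field_simp
      _ ≤ 1 / r := by gcongr; exact h.1.le
  · simp; positivity

lemma glog_supp (c : Plane) (r R : ℝ) (k : Fin 2) (z : Plane) (h : z ∉ ball c R \ ball c r) :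
    glog c r R k z = 0 := by
  unfold glog
  rw [if_neg]
  rintro ⟨h1, h2⟩
  refine h ⟨by simpa [dist_eq_norm] using h2, by simpa [dist_eq_norm] using h1.le⟩

lemma wlog_line_deriv (c z : Plane) (r R : ℝ) (hr : 0 < r) (hrR : r ≤ R) (k : Fin 2) (τ : ℝ)
    (h1 : ‖z + τ • ev k - c‖ ≠ r) (h2 : ‖z + τ • ev k - c‖ ≠ R) :
    HasDerivAt (fun τ : ℝ => wlog c r R (z + τ • ev k)) (glog c r R k (z + τ • ev k)) τ := by
  have hc : Continuous (fun τ : ℝ => ‖z + τ • ev k - c‖) := by fun_prop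
  rcases lt_or_gt_of_ne h1 with h1 | h1
  · have : glog c r R k (z + τ • ev k) = 0 := by
      unfold glog; rw [if_neg]; intro h; linarith [h.1]
    rw [this]
    refine (hasDerivAt_const τ (Real.log R - Real.log r)).congr_of_eventuallyEq ?_
    filter_upwards [hc.continuousAt.eventually_lt continuousAt_const h1] with s hs
    unfold wlog
    rw [max_eq_left]
    exact (min_le_left _ _).trans hs.le
  rcases lt_or_gt_of_ne h2 with h2 | h2
  · have hg : glog c r R k (z + τ • ev k) =
      -(((z + τ • ev k) k - c k) / ‖z + τ • ev k - c‖ ^ 2) := by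
      unfold glog; rw [if_pos ⟨h1, h2⟩]
    have hpos : 0 < ‖z + τ • ev k - c‖ := hr.trans h1
    have hsq : ∀ s : ℝ, ‖z + s • ev k - c‖ ^ 2 =
        ‖z + τ • ev k - c‖ ^ 2 + 2 * (s - τ) * ((z + τ • ev k) k - c k) + (s - τ) ^ 2 := by
      intro s
      rw [plane_norm_sq, plane_norm_sq]
      fin_cases k <;> simp [ev] <;> ring
    have hd : HasDerivAt (fun s : ℝ => ‖z + s • ev k - c‖ ^ 2)
        (2 * ((z + τ • ev k) k - c k)) τ := by
      have : HasDerivAt (fun s : ℝ => ‖z + τ • ev k - c‖ ^ 2 + 2 * (s - τ) * ((z + τ • ev k) k - c k)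
        + (s - τ) ^ 2) (0 + 2 * 1 * ((z + τ • ev k) k - c k) + 2 * (τ - τ) ^ 1 * 1) τ := by
        refine HasDerivAt.add (HasDerivAt.add (hasDerivAt_const _ _) ?_) ?_
        · exact (((hasDerivAt_id τ).sub_const τ).const_mul 2).mul_const _
        · exact ((hasDerivAt_id τ).sub_const τ).pow 2
      rw [funext hsq]
      convert! this using 1
      ring
    have hl := (hd.log (by positivity)).const_mul (1 / 2 : ℝ)
    rw [hg]
    have hl2 := hl.const_sub (Real.log R)
    have heq : -(((z + τ • ev k) k - c k) / ‖z + τ • ev k - c‖ ^ 2) =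
      -(1 / 2 * (2 * ((z + τ • ev k) k - c k) / ‖z + τ • ev k - c‖ ^ 2)) := by ring
    rw [heq]
    refine hl2.congr_of_eventuallyEq ?_
    filter_upwards [continuousAt_const.eventually_lt hc.continuousAt h1,
      hc.continuousAt.eventually_lt continuousAt_const h2] with s hs hs'
    unfold wlog
    rw [min_eq_left hs'.le, max_eq_right hs.le, Real.log_pow]
    push_cast
    ring
  · have : glog c r R k (z + τ • ev k) = 0 := by
      unfold glog; rw [if_neg]; intro h; linarith [h.2]
    rw [this]
    refine (hasDerivAt_const τ (Real.log R - Real.log R)).congr_of_eventuallyEq ?_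
    filter_upwards [continuousAt_const.eventually_lt hc.continuousAt h2] with s hs
    unfold wlog
    rw [min_eq_right hs.le, max_eq_right hrR]

lemma line_sphere_finite (c z : Plane) (k : Fin 2) (r : ℝ) :
    {τ : ℝ | ‖z + τ • ev k - c‖ = r}.Finite := by
  set b := z k - c k
  set K := ‖z - c‖ ^ 2
  have : {τ : ℝ | ‖z + τ • ev k - c‖ = r} ⊆
      {-b + Real.sqrt (r ^ 2 - K + b ^ 2), -b - Real.sqrt (r ^ 2 - K + b ^ 2)} := by
    intro τ hτ
    have hτ' : ‖z + τ • ev k - c‖ = r := hτ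
    have h2 : (τ + b) ^ 2 = r ^ 2 - K + b ^ 2 := by
      rw [← hτ']
      simp only [K, b]
      rw [plane_norm_sq, plane_norm_sq]
      fin_cases k <;> simp [ev] <;> ring
    have h3 := Real.sqrt_sq_eq_abs (τ + b)
    rw [h2] at h3
    rw [h3]
    simp only [Set.mem_insert_iff, Set.mem_singleton_iff]
    rcases abs_choice (τ + b) with h | h <;> rw [h]
    · left; ring
    · right; ring
  exact (Set.toFinite _).subset this

lemma wlog_ftc (c z : Plane) (r R : ℝ) (hr : 0 < r) (hrR : r ≤ R) (k : Fin 2) :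
    ∫ τ in (0:ℝ)..1, glog c r R k (z + τ • ev k) = wlog c r R (z + ev k) - wlog c r R z := by
  have := MeasureTheory.integral_eq_of_hasDerivAt_off_countable_of_le
    (fun τ : ℝ => wlog c r R (z + τ • ev k)) (fun τ : ℝ => glog c r R k (z + τ • ev k))
    (a := 0) (b := 1) zero_le_one
    ((line_sphere_finite c z k r).union (line_sphere_finite c z k R)).countable ?_ ?_ ?_
  · simpa using this
  · exact ((wlog_continuous c r R hr).comp (by fun_prop)).continuousOn
  · intro τ hτ
    have h := hτ.2
    simp only [Set.mem_union, Set.mem_ofPred_eq, not_or] at h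
    exact wlog_line_deriv c z r R hr hrR k τ h.1 h.2
  · rw [intervalIntegrable_iff_integrableOn_Icc_of_le zero_le_one]
    refine Measure.integrableOn_of_bounded (M := 1 / r) (by simp) ?_ ?_
    · exact ((glog_measurable c r R k).comp (by fun_prop)).aestronglyMeasurable
    · exact Filter.Eventually.of_forall fun τ => glog_bound c r R hr k _

lemma glog_sq_integrable (c : Plane) (r R : ℝ) (hr : 0 < r) (k : Fin 2) :
    Integrable (fun z => glog c r R k z ^ 2) := by
  have h : IntegrableOn (fun z => glog c r R k z ^ 2) (ball c R) := by
    refine Measure.integrableOn_of_bounded (M := (1 / r) ^ 2) measure_ball_lt_top.ne ?_ ?_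
    · exact ((glog_measurable c r R k).pow_const 2).aestronglyMeasurable
    · refine Filter.Eventually.of_forall fun z => ?_
      rw [Real.norm_of_nonneg (by positivity), ← sq_abs]
      exact pow_le_pow_left₀ (abs_nonneg _) (glog_bound c r R hr k z) 2
  rw [← integrableOn_univ]
  refine h.of_forall_sdiff_eq_zero MeasurableSet.univ ?_
  intro z hz
  rw [glog_supp]
  · simp
  · intro h'; exact hz.2 h'.1

lemma glog_energy (c : Plane) (r R : ℝ) (hr : 0 < r) (hrR : r ≤ R) :
    (∫ z, glog c r R 0 z ^ 2) + (∫ z, glog c r R 1 z ^ 2) = 2 * Real.pi * Real.log (R / r) := by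
  rw [← integral_add (glog_sq_integrable c r R hr 0) (glog_sq_integrable c r R hr 1)]
  set F : ℝ → ℝ := (Set.Ioo r R).indicator (fun s => (s ^ 2)⁻¹)
  have h1 : ∀ z : Plane, glog c r R 0 z ^ 2 + glog c r R 1 z ^ 2 = F ‖z - c‖ := by
    intro z
    unfold glog
    by_cases h : r < ‖z - c‖ ∧ ‖z - c‖ < R
    · have h0 : 0 < ‖z - c‖ := hr.trans h.1
      have h2 := plane_norm_sq (z - c)
      simp only [PiLp.sub_apply] at h2
      rw [if_pos h, if_pos h]
      simp only [F]
      rw [Set.indicator_of_mem (by exact h)]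
      rw [neg_sq, neg_sq, div_pow, div_pow, ← add_div, ← h2]
      field_simp
    · rw [if_neg h, if_neg h]
      simp only [F]
      rw [Set.indicator_of_notMem (by exact h)]
      simp
  simp_rw [h1]
  rw [integral_sub_right_eq_self (fun z : Plane => F ‖z‖) c, integral_fun_norm_addHaar]
  have hv : (volume : Measure Plane).real (ball 0 1) = Real.pi := by
    rw [measureReal_def, InnerProductSpace.volume_ball_of_dim_even (k := 1) (by simp)]
    simp [Real.pi_nonneg]
  rw [hv]
  have hdim : Module.finrank ℝ Plane = 2 := by simp
  rw [hdim]
  have h3 : ∫ y in Set.Ioi (0:ℝ), y ^ (2 - 1) • F y = Real.log (R / r) := by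
    have h4 : ∀ y : ℝ, y ^ (2 - 1) • F y = (Set.Ioo r R).indicator (fun s => s⁻¹) y := by
      intro y
      simp only [F]
      by_cases hy : y ∈ Set.Ioo r R
      · rw [Set.indicator_of_mem hy, Set.indicator_of_mem hy]
        have : 0 < y := hr.trans hy.1
        simp; field_simp
      · rw [Set.indicator_of_notMem hy, Set.indicator_of_notMem hy]; simp
    simp_rw [h4]
    rw [setIntegral_indicator measurableSet_Ioo,
      Set.inter_eq_right.2 (fun y (hy : y ∈ Set.Ioo r R) => Set.mem_Ioi.2 (hr.trans hy.1)), ← integral_Ioc_eq_integral_Ioo,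
      ← intervalIntegral.integral_of_le hrR, integral_inv_of_pos hr (hr.trans_le hrR)]
  rw [h3]
  simp
  ring

@[simp] lemma toPlane_zero (i : ℤ × ℤ) : toPlane i 0 = (i.1 : ℝ) := by simp [toPlane]
@[simp] lemma toPlane_one (i : ℤ × ℤ) : toPlane i 1 = (i.2 : ℝ) := by simp [toPlane]

lemma toPlane_sub_e0 (i : ℤ × ℤ) : toPlane (i - (1, 0)) = toPlane i - ev 0 := by
  ext k; fin_cases k <;> simp [toPlane, ev]

lemma toPlane_sub_e1 (i : ℤ × ℤ) : toPlane (i - (0, 1)) = toPlane i - ev 1 := by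
  ext k; fin_cases k <;> simp [toPlane, ev]

/-- the half-open unit square -/
def Q0 : Set Plane := {y | (0 ≤ y 0 ∧ y 0 < 1) ∧ (0 ≤ y 1 ∧ y 1 < 1)}

lemma Q0_measurable : MeasurableSet Q0 := by
  have h0 : Measurable (fun y : Plane => y 0) := by fun_prop
  have h1 : Measurable (fun y : Plane => y 1) := by fun_prop
  exact ((measurableSet_le measurable_const h0).inter (measurableSet_lt h0 measurable_const)).inter
    ((measurableSet_le measurable_const h1).inter (measurableSet_lt h1 measurable_const))

lemma Q0_volume : (volume : Measure Plane) Q0 = 1 := by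
  have h : Q0 = (@WithLp.ofLp 2 (Fin 2 → ℝ)) ⁻¹' (Set.pi Set.univ fun _ => Set.Ico (0:ℝ) 1) := by
    ext y
    simp [Q0, Fin.forall_fin_two]
  rw [h, (PiLp.volume_preserving_ofLp (Fin 2)).measure_preimage
    (MeasurableSet.univ_pi fun _ => measurableSet_Ico).nullMeasurableSet, Real.volume_pi_Ico]
  simp

/-- shift measure -/
noncomputable def shiftP : Measure (Plane × ℝ) :=
  (volume.restrict Q0).prod (volume.restrict (Set.Ioc (0:ℝ) 1))

instance : IsProbabilityMeasure ((volume : Measure Plane).restrict Q0) :=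
  ⟨by rw [Measure.restrict_apply_univ, Q0_volume]⟩

instance : IsProbabilityMeasure ((volume : Measure ℝ).restrict (Set.Ioc (0:ℝ) 1)) :=
  ⟨by rw [Measure.restrict_apply_univ]; simp⟩

instance : IsProbabilityMeasure shiftP := by unfold shiftP; infer_instance

/-- transport map for an edge -/
noncomputable def Tm (k : Fin 2) (i : ℤ × ℤ) (x : Plane × ℝ) : Plane :=
  (toPlane i - ev k + x.1) + x.2 • ev k

lemma Tm_continuous (k : Fin 2) (i : ℤ × ℤ) : Continuous (Tm k i) := by
  unfold Tm; fun_prop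

lemma Tm_measurable (k : Fin 2) (i : ℤ × ℤ) : Measurable (Tm k i) := (Tm_continuous k i).measurable

lemma tile_disjoint (b : Plane) (i j : ℤ × ℤ) (h : i ≠ j) :
    Disjoint {z : Plane | z - (toPlane i + b) ∈ Q0} {z : Plane | z - (toPlane j + b) ∈ Q0} := by
  rw [Set.disjoint_left]
  rintro z ⟨⟨h1, h2⟩, h3, h4⟩ ⟨⟨h1', h2'⟩, h3', h4'⟩
  simp only [PiLp.sub_apply, PiLp.add_apply, toPlane_zero, toPlane_one] at *
  apply h
  have key : ∀ a b : ℤ, ∀ s t : ℝ, 0 ≤ s - (a + t) → s - (a + t) < 1 → 0 ≤ s - (b + t) →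
      s - (b + t) < 1 → a = b := by
    intro a b s t h1 h2 h3 h4
    have h5 : (a : ℝ) < b + 1 := by linarith
    have h6 : (b : ℝ) < a + 1 := by linarith
    have h5' : a < b + 1 := by exact_mod_cast h5
    have h6' : b < a + 1 := by exact_mod_cast h6
    omega
  exact Prod.ext (key _ _ _ _ h1 h2 h1' h2') (key _ _ _ _ h3 h4 h3' h4')

lemma tile_le (b : Plane) (E : Finset (ℤ × ℤ)) (s : Set Plane) (hs : MeasurableSet s) :
    ∑ i ∈ E, (volume.restrict Q0) ((fun y : Plane => (toPlane i + b) + y) ⁻¹' s) ≤ volume s := by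
  have hmeas : ∀ i : ℤ × ℤ, MeasurableSet {z : Plane | z - (toPlane i + b) ∈ Q0} := fun i =>
    (measurable_id.sub_const _) Q0_measurable
  have h1 : ∀ i, (volume.restrict Q0) ((fun y : Plane => (toPlane i + b) + y) ⁻¹' s)
      = volume (s ∩ {z : Plane | z - (toPlane i + b) ∈ Q0}) := by
    intro i
    rw [Measure.restrict_apply ((measurable_const_add _) hs),
      ← measure_preimage_add volume (toPlane i + b) (s ∩ _)]
    congr 1
    ext y
    simp
  simp_rw [h1]
  rw [← measure_biUnion_finset]
  · exact measure_mono (Set.iUnion₂_subset fun i _ => Set.inter_subset_left)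
  · intro i _ j _ hij
    exact (tile_disjoint b i j hij).mono Set.inter_subset_right Set.inter_subset_right
  · exact fun i _ => hs.inter (hmeas i)

lemma shift_le (k : Fin 2) (E : Finset (ℤ × ℤ)) :
    ∑ i ∈ E, shiftP.map (Tm k i) ≤ (volume : Measure Plane) := by
  rw [Measure.le_iff]
  intro s hs
  rw [Measure.finset_sum_apply]
  have h1 : ∀ i, shiftP.map (Tm k i) s = ∫⁻ τ in Set.Ioc (0:ℝ) 1, (volume.restrict Q0)
      ((fun y : Plane => (toPlane i + (-ev k + τ • ev k)) + y) ⁻¹' s) := by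
    intro i
    rw [Measure.map_apply (Tm_measurable k i) hs, shiftP,
      Measure.prod_apply_symm (Tm_measurable k i hs)]
    refine lintegral_congr fun τ => ?_
    congr 1
    ext y
    simp only [Set.mem_preimage, Tm]
    rw [show toPlane i - ev k + y + τ • ev k = toPlane i + (-ev k + τ • ev k) + y by abel]
  simp_rw [h1]
  rw [← lintegral_finset_sum']
  · calc _ ≤ ∫⁻ τ in Set.Ioc (0:ℝ) 1, volume s := lintegral_mono fun τ => tile_le _ E s hs
      _ = volume s := by simp
  · intro i _
    have := measurable_measure_prodMk_right (μ := (volume.restrict Q0 : Measure Plane))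
      (Tm_measurable k i hs)
    convert! this.aemeasurable using 3 with τ
    ext y
    simp only [Set.mem_preimage, Tm]
    rw [show toPlane i - ev k + y + τ • ev k = toPlane i + (-ev k + τ • ev k) + y by abel]

/-- energy measure of one family of edges -/
noncomputable def nuk (k : Fin 2) (E : Finset (ℤ × ℤ)) (α : ℤ × ℤ → ℝ) : Measure Plane :=
  ∑ i ∈ E, ENNReal.ofReal (α i ^ 2) • shiftP.map (Tm k i)

instance (k : Fin 2) (i : ℤ × ℤ) : IsProbabilityMeasure (shiftP.map (Tm k i)) :=
  Measure.isProbabilityMeasure_map (Tm_measurable k i).aemeasurable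

lemma nuk_apply (k : Fin 2) (E : Finset (ℤ × ℤ)) (α : ℤ × ℤ → ℝ) (s : Set Plane) :
    nuk k E α s = ∑ i ∈ E, ENNReal.ofReal (α i ^ 2) * shiftP.map (Tm k i) s := by
  simp [nuk, Measure.finset_sum_apply]

instance (k : Fin 2) (E : Finset (ℤ × ℤ)) (α : ℤ × ℤ → ℝ) : IsFiniteMeasure (nuk k E α) := by
  refine ⟨?_⟩
  rw [nuk_apply]
  exact ENNReal.sum_lt_top.2 fun i _ => ENNReal.mul_lt_top ENNReal.ofReal_lt_top (measure_lt_top _ _)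

lemma nuk_real (k : Fin 2) (E : Finset (ℤ × ℤ)) (α : ℤ × ℤ → ℝ) (s : Set Plane) :
    (nuk k E α).real s = ∑ i ∈ E, α i ^ 2 * (shiftP.map (Tm k i)).real s := by
  rw [measureReal_def, nuk_apply, ENNReal.toReal_sum]
  · refine Finset.sum_congr rfl fun i _ => ?_
    rw [ENNReal.toReal_mul, ENNReal.toReal_ofReal (by positivity), measureReal_def]
  · exact fun i _ => ENNReal.mul_ne_top ENNReal.ofReal_ne_top (measure_ne_top _ _)

lemma glog_map_integral (c : Plane) (r R : ℝ) (hr : 0 < r) (hrR : r ≤ R) (k : Fin 2) (i : ℤ × ℤ) :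
    ∫ z, glog c r R k z ∂(shiftP.map (Tm k i)) =
      ∫ y in Q0, (wlog c r R (toPlane i + y) - wlog c r R (toPlane i - ev k + y)) := by
  have hm := glog_measurable c r R k
  rw [integral_map (Tm_measurable k i).aemeasurable hm.aestronglyMeasurable, shiftP,
    integral_prod]
  · refine integral_congr_ae (Filter.Eventually.of_forall fun y => ?_)
    simp only [Tm]
    rw [← intervalIntegral.integral_of_le zero_le_one, wlog_ftc c _ r R hr hrR k]
    congr 2
    abel
  · refine Integrable.of_bound (C := 1 / r) ?_ ?_
    · exact (hm.comp (Tm_measurable k i)).aestronglyMeasurable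
    · exact Filter.Eventually.of_forall fun x => glog_bound c r R hr k _

lemma nuk_lower (k : Fin 2) (E : Finset (ℤ × ℤ)) (α : ℤ × ℤ → ℝ) (c : Plane) (r R : ℝ) (hr : 0 < r)
    (hrR : r ≤ R) (κ : ℝ) :
    2 * κ * ∑ i ∈ E, α i * (∫ y in Q0, (wlog c r R (toPlane i + y) - wlog c r R (toPlane i - ev k + y)))
      - κ ^ 2 * ∫ z, glog c r R k z ^ 2 ≤ (nuk k E α).real (ball c R \ ball c r) := by
  have hm := glog_measurable c r R k
  set A := ball c R \ ball c r
  have hAm : MeasurableSet A := measurableSet_ball.diff measurableSet_ball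
  have hi1 : ∀ i, Integrable (glog c r R k) (shiftP.map (Tm k i)) := fun i =>
    Integrable.of_bound (C := 1 / r) hm.aestronglyMeasurable
      (Filter.Eventually.of_forall fun x => glog_bound c r R hr k _)
  have hi2 : ∀ i, Integrable (fun z => glog c r R k z ^ 2) (shiftP.map (Tm k i)) := fun i =>
    Integrable.of_bound (C := (1 / r) ^ 2) (hm.pow_const 2).aestronglyMeasurable
      (Filter.Eventually.of_forall fun x => by
        rw [Real.norm_of_nonneg (by positivity), ← sq_abs]
        exact pow_le_pow_left₀ (abs_nonneg _) (glog_bound c r R hr k x) 2)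
  have htile : ∑ i ∈ E, ∫ z, glog c r R k z ^ 2 ∂(shiftP.map (Tm k i)) ≤ ∫ z, glog c r R k z ^ 2 := by
    rw [← integral_finset_sum_measure (fun i _ => hi2 i)]
    exact integral_mono_measure (shift_le k E)
      (Filter.Eventually.of_forall fun z => sq_nonneg _) (glog_sq_integrable c r R hr k)
  have hone : ∀ i, 2 * κ * (α i * ∫ z, glog c r R k z ∂(shiftP.map (Tm k i)))
      - κ ^ 2 * ∫ z, glog c r R k z ^ 2 ∂(shiftP.map (Tm k i))
      ≤ α i ^ 2 * (shiftP.map (Tm k i)).real A := by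
    intro i
    rw [← integral_indicator_one hAm, ← integral_const_mul, ← integral_const_mul,
      ← integral_const_mul, ← integral_const_mul, ← integral_sub]
    · refine integral_mono ?_ ?_ ?_
      · exact (((hi1 i).const_mul _).const_mul _).sub ((hi2 i).const_mul _)
      · exact ((integrable_const (1:ℝ)).indicator hAm).const_mul _
      · intro z
        by_cases hz : z ∈ A
        · simp only [Set.indicator_of_mem hz, Pi.one_apply]
          nlinarith [sq_nonneg (α i - κ * glog c r R k z)]
        · simp only [Set.indicator_of_notMem hz, glog_supp c r R k z hz]
          simp
    · exact ((hi1 i).const_mul _).const_mul _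
    · exact (hi2 i).const_mul _
  rw [nuk_real]
  simp_rw [← glog_map_integral c r R hr hrR k]
  calc _ ≤ 2 * κ * ∑ i ∈ E, α i * (∫ z, glog c r R k z ∂(shiftP.map (Tm k i)))
      - κ ^ 2 * ∑ i ∈ E, ∫ z, glog c r R k z ^ 2 ∂(shiftP.map (Tm k i)) := by
        gcongr
    _ = ∑ i ∈ E, (2 * κ * (α i * ∫ z, glog c r R k z ∂(shiftP.map (Tm k i)))
      - κ ^ 2 * ∫ z, glog c r R k z ^ 2 ∂(shiftP.map (Tm k i))) := by
        rw [Finset.mul_sum, Finset.mul_sum, Finset.sum_sub_distrib]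
    _ ≤ _ := Finset.sum_le_sum fun i _ => hone i

/-- circulation of a discrete 1-form -/
def circ (α₀ α₁ : ℤ × ℤ → ℝ) (i : ℤ × ℤ) : ℝ :=
  α₀ i + α₁ (i + (1, 0)) - α₀ (i + (0, 1)) - α₁ i

lemma shift_sum (E : Finset (ℤ × ℤ)) (α ψ : ℤ × ℤ → ℝ) (e : ℤ × ℤ)
    (hE : ∀ i, ψ i ≠ 0 → i ∈ E ∧ i + e ∈ E) :
    ∑ i ∈ E, α i * ψ (i - e) = ∑ i ∈ E, α (i + e) * ψ i := by
  have h1 : ∑ i ∈ E, α i * ψ (i - e) = ∑ i ∈ E with ψ (i - e) ≠ 0, α i * ψ (i - e) := by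
    rw [Finset.sum_filter]
    refine Finset.sum_congr rfl fun i _ => ?_
    split_ifs with h
    · rfl
    · push Not at h; rw [h, mul_zero]
  have h2 : ∑ i ∈ E, α (i + e) * ψ i = ∑ i ∈ E with ψ i ≠ 0, α (i + e) * ψ i := by
    rw [Finset.sum_filter]
    refine Finset.sum_congr rfl fun i _ => ?_
    split_ifs with h
    · rfl
    · push Not at h; rw [h, mul_zero]
  rw [h1, h2]
  refine Finset.sum_nbij' (fun i => i - e) (fun i => i + e) ?_ ?_ ?_ ?_ ?_
  · intro i hi
    rw [Finset.mem_filter] at hi ⊢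
    exact ⟨(hE _ hi.2).1, hi.2⟩
  · intro i hi
    rw [Finset.mem_filter] at hi ⊢
    rw [add_sub_cancel_right]
    exact ⟨(hE _ hi.2).2, hi.2⟩
  · intro i _; simp
  · intro i _; simp
  · intro i _; simp

lemma sum_by_parts (E₀ E₁ : Finset (ℤ × ℤ)) (α₀ α₁ ψ : ℤ × ℤ → ℝ)
    (h₀ : ∀ i, ψ i ≠ 0 → i ∈ E₀ ∧ i + (0, 1) ∈ E₀)
    (h₁ : ∀ i, ψ i ≠ 0 → i ∈ E₁ ∧ i + (1, 0) ∈ E₁) :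
    ∑ i ∈ E₀, α₀ i * (ψ i - ψ (i - (0, 1))) - ∑ i ∈ E₁, α₁ i * (ψ i - ψ (i - (1, 0)))
      = ∑ i ∈ E₀, circ α₀ α₁ i * ψ i := by
  have hsub : ∀ β : ℤ × ℤ → ℝ, ∑ i ∈ E₁, β i * ψ i = ∑ i ∈ E₀, β i * ψ i := by
    intro β
    have k1 : ∑ i ∈ E₁, β i * ψ i = ∑ i ∈ E₁ ∪ E₀, β i * ψ i := by
      refine Finset.sum_subset Finset.subset_union_left fun i _ hi => ?_
      by_contra h
      exact hi (h₁ i (right_ne_zero_of_mul h)).1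
    have k2 : ∑ i ∈ E₀, β i * ψ i = ∑ i ∈ E₁ ∪ E₀, β i * ψ i := by
      refine Finset.sum_subset Finset.subset_union_right fun i _ hi => ?_
      by_contra h
      exact hi (h₀ i (right_ne_zero_of_mul h)).1
    rw [k1, k2]
  simp only [mul_sub, Finset.sum_sub_distrib]
  rw [shift_sum E₀ α₀ ψ (0, 1) h₀, shift_sum E₁ α₁ ψ (1, 0) h₁, hsub α₁,
    hsub (fun i => α₁ (i + (1, 0)))]
  rw [← Finset.sum_sub_distrib, ← Finset.sum_sub_distrib, ← Finset.sum_sub_distrib]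
  refine Finset.sum_congr rfl fun i _ => ?_
  unfold circ
  ring

lemma wlog_in (c z : Plane) (r R : ℝ) (hr : 0 < r) (hrR : r ≤ R) (h : z ∈ ball c r) :
    wlog c r R z = Real.log (R / r) := by
  have h' : ‖z - c‖ < r := by simpa [dist_eq_norm] using h
  unfold wlog
  rw [max_eq_left ((min_le_left _ _).trans h'.le), Real.log_div (by linarith) hr.ne']

lemma wlog_out (c z : Plane) (r R : ℝ) (hrR : r ≤ R) (h : z ∉ ball c R) :
    wlog c r R z = 0 := by
  have h' : R ≤ ‖z - c‖ := by simpa [dist_eq_norm] using h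
  unfold wlog
  rw [min_eq_right h', max_eq_right hrR, sub_self]

lemma Q0_norm (y : Plane) (hy : y ∈ Q0) : ‖y‖ < 3 / 2 := by
  obtain ⟨⟨h1, h2⟩, h3, h4⟩ := hy
  have := plane_norm_sq y
  nlinarith [norm_nonneg y]

theorem annProp (E₀ E₁ VF : Finset (ℤ × ℤ)) (α₀ α₁ : ℤ × ℤ → ℝ) (U : Set Plane)
    (hcint : ∀ i, ∃ n : ℤ, circ α₀ α₁ i = n)
    (hU : ∀ i, (∃ y ∈ Q0, toPlane i + y ∈ U) →
      i ∈ E₀ ∧ i + (0, 1) ∈ E₀ ∧ i ∈ E₁ ∧ i + (1, 0) ∈ E₁ ∧ (circ α₀ α₁ i ≠ 0 → i ∈ VF)) :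
    AnnProp (V := VF) (nuk 1 E₀ α₀ + nuk 0 E₁ α₁) U (fun p => toPlane p) 3 (1 / (2 * Real.pi))
      (fun p => circ α₀ α₁ p) := by
  intro c r R hr hrR hcU I hI hI'
  set D := ∑ p ∈ I, circ α₀ α₁ p with hD
  set ℓ := Real.log (R / r)
  have hℓ : 0 ≤ ℓ := Real.log_nonneg (by rw [le_div_iff₀ hr]; linarith)
  have hwc := wlog_continuous c r R hr
  -- the pointwise identity
  have hpt : ∀ y ∈ Q0, ∑ i ∈ E₀, α₀ i * (wlog c r R (toPlane i + y) - wlog c r R (toPlane i - ev 1 + y))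
      - ∑ i ∈ E₁, α₁ i * (wlog c r R (toPlane i + y) - wlog c r R (toPlane i - ev 0 + y)) = D * ℓ := by
    intro y hy
    have hne : ∀ i, wlog c r R (toPlane i + y) ≠ 0 → toPlane i + y ∈ U := by
      intro i hi
      by_contra h
      exact hi (wlog_out c _ r R hrR fun h' => h (hcU h'))
    have := sum_by_parts E₀ E₁ α₀ α₁ (fun i => wlog c r R (toPlane i + y))
      (fun i hi => by have := hU i ⟨y, hy, hne i hi⟩; exact ⟨this.1, this.2.1⟩)
      (fun i hi => by have := hU i ⟨y, hy, hne i hi⟩; exact ⟨this.2.2.1, this.2.2.2.1⟩)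
    simp only [toPlane_sub_e0, toPlane_sub_e1] at this
    rw [this]
    have k1 : ∑ i ∈ E₀, circ α₀ α₁ i * wlog c r R (toPlane i + y)
        = ∑ i ∈ E₀ ∪ VF, circ α₀ α₁ i * wlog c r R (toPlane i + y) := by
      refine Finset.sum_subset Finset.subset_union_left fun i _ hi => ?_
      by_contra h
      exact hi (hU i ⟨y, hy, hne i (right_ne_zero_of_mul h)⟩).1
    have k2 : ∑ i ∈ VF, circ α₀ α₁ i * wlog c r R (toPlane i + y)
        = ∑ i ∈ E₀ ∪ VF, circ α₀ α₁ i * wlog c r R (toPlane i + y) := by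
      refine Finset.sum_subset Finset.subset_union_right fun i _ hi => ?_
      by_contra h
      exact hi ((hU i ⟨y, hy, hne i (right_ne_zero_of_mul h)⟩).2.2.2.2 (left_ne_zero_of_mul h))
    rw [k1, ← k2, ← Finset.sum_coe_sort VF, hD, Finset.sum_mul]
    symm
    have hcore : ∀ p : VF, toPlane p + y ∈ ball (toPlane p) 3 := by
      intro p
      rw [mem_ball, dist_eq_norm, add_sub_cancel_left]
      linarith [Q0_norm y hy]
    calc ∑ p ∈ I, circ α₀ α₁ p * ℓ = ∑ p ∈ I, circ α₀ α₁ p * wlog c r R (toPlane p + y) := by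
          refine Finset.sum_congr rfl fun p hp => ?_
          rw [wlog_in c _ r R hr hrR (hI p hp (hcore p))]
      _ = _ := by
          refine Finset.sum_subset (Finset.subset_univ _) fun p _ hp => ?_
          rw [wlog_out c _ r R hrR (Set.disjoint_left.1 (hI' p hp) (hcore p)), mul_zero]
  have hwb : ∀ z, |wlog c r R z| ≤ |Real.log R| + |Real.log R| + |Real.log r| := by
    intro z
    unfold wlog
    rcases le_total (min ‖z - c‖ R) r with h | h
    · rw [max_eq_left h]
      exact (abs_sub _ _).trans (by linarith [abs_nonneg (Real.log R)])
    · rw [max_eq_right h]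
      have h1 : Real.log (min ‖z - c‖ R) ≤ Real.log R :=
        Real.log_le_log (hr.trans_le h) (min_le_right _ _)
      have h2 : Real.log r ≤ Real.log (min ‖z - c‖ R) := Real.log_le_log hr h
      rw [abs_le]
      constructor <;> linarith [neg_abs_le (Real.log R), neg_abs_le (Real.log r), le_abs_self (Real.log R),
        abs_nonneg (Real.log r), abs_nonneg (Real.log R)]
  have hwi : ∀ v : Plane, Integrable (fun y => wlog c r R (v + y)) (volume.restrict Q0) := by
    intro v
    refine Integrable.of_bound (C := |Real.log R| + |Real.log R| + |Real.log r|) ?_ ?_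
    · exact (hwc.comp (by fun_prop)).aestronglyMeasurable
    · exact Filter.Eventually.of_forall fun y => hwb _
  have hint2 : ∑ i ∈ E₀, α₀ i * (∫ y in Q0, (wlog c r R (toPlane i + y) - wlog c r R (toPlane i - ev 1 + y)))
      - ∑ i ∈ E₁, α₁ i * (∫ y in Q0, (wlog c r R (toPlane i + y) - wlog c r R (toPlane i - ev 0 + y)))
      = D * ℓ := by
    simp_rw [← integral_const_mul]
    rw [← integral_finset_sum, ← integral_finset_sum, ← integral_sub]
    · rw [setIntegral_congr_fun Q0_measurable hpt]
      simp
    · exact integrable_finset_sum _ fun i _ => ((hwi _).sub (hwi _)).const_mul _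
    · exact integrable_finset_sum _ fun i _ => ((hwi _).sub (hwi _)).const_mul _
    · exact fun i _ => ((hwi _).sub (hwi _)).const_mul _
    · exact fun i _ => ((hwi _).sub (hwi _)).const_mul _
  set κ := D / (2 * Real.pi)
  have l0 := nuk_lower 1 E₀ α₀ c r R hr hrR κ
  have l1 := nuk_lower 0 E₁ α₁ c r R hr hrR (-κ)
  have hen := glog_energy c r R hr hrR
  rw [measureReal_add_apply]
  have hDD : |D| ≤ D ^ 2 := by
    have : ∃ n : ℤ, D = n := by
      choose f hf using hcint
      refine ⟨∑ p ∈ I, f p, ?_⟩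
      rw [hD]; push_cast
      exact Finset.sum_congr rfl fun p _ => hf p
    obtain ⟨n, hn⟩ := this
    rw [hn]
    have : |n| ≤ n ^ 2 := by
      rw [← sq_abs]
      rcases (abs_nonneg n).eq_or_lt with h | h
      · rw [← h]; simp
      · nlinarith
    exact_mod_cast this
  have hpi := Real.pi_pos
  have hmain : 2 * κ * (D * ℓ) - κ ^ 2 * (2 * Real.pi * ℓ) = 1 / (2 * Real.pi) * ℓ * D ^ 2 := by
    simp only [κ]; field_simp; ring
  have : 1 / (2 * Real.pi) * ℓ * |D| ≤ 1 / (2 * Real.pi) * ℓ * D ^ 2 := by gcongr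
  refine this.trans ?_
  rw [← hmain, ← hint2, ← hen]
  nlinarith [l0, l1]

lemma ev_norm (k : Fin 2) : ‖ev k‖ = 1 := by simp [ev]

/-- If an edge starts at `p` or at the upper/right neighbour of `p`, its transported mass stays in the core ball. -/
lemma Tm_core (k : Fin 2) (p i : ℤ × ℤ) (s : Set Plane) (hs : ball (toPlane p) 3 ⊆ s)
    (h : ‖toPlane i - toPlane p‖ = 0 ∨ toPlane i - ev k = toPlane p) :
    (shiftP.map (Tm k i)).real s = 1 := by
  have h1 : ∀ᵐ x ∂shiftP, x.1 ∈ Q0 ∧ x.2 ∈ Set.Ioc (0:ℝ) 1 := by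
    have : shiftP = (volume.prod volume).restrict (Q0 ×ˢ Set.Ioc (0:ℝ) 1) := by
      rw [shiftP, Measure.prod_restrict]
    rw [this]
    filter_upwards [ae_restrict_mem (Q0_measurable.prod measurableSet_Ioc)] with x hx
    exact hx
  have h2 : (shiftP.map (Tm k i)) (ball (toPlane p) 3) = 1 := by
    rw [Measure.map_apply (Tm_measurable k i) measurableSet_ball]
    rw [prob_compl_eq_zero_iff ((Tm_measurable k i) measurableSet_ball) |>.1]
    rw [← mem_ae_iff]
    filter_upwards [h1] with x hx
    have hq := Q0_norm _ hx.1
    simp only [Set.mem_preimage, mem_ball, dist_eq_norm, Tm]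
    have e := ev_norm k
    rcases h with h | h
    · have : toPlane i = toPlane p := by rwa [norm_eq_zero, sub_eq_zero] at h
      rw [this, show toPlane p - ev k + x.1 + x.2 • ev k - toPlane p = x.1 + (x.2 - 1) • ev k by
        rw [sub_smul, one_smul]; abel]
      calc _ ≤ ‖x.1‖ + ‖(x.2 - 1) • ev k‖ := norm_add_le _ _
        _ < 3 := by
          rw [norm_smul, e, Real.norm_eq_abs, mul_one]
          have : |x.2 - 1| ≤ 1 := by rw [abs_le]; constructor <;> linarith [hx.2.1, hx.2.2]
          linarith
    · rw [h, show toPlane p + x.1 + x.2 • ev k - toPlane p = x.1 + x.2 • ev k by abel]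
      calc _ ≤ ‖x.1‖ + ‖x.2 • ev k‖ := norm_add_le _ _
        _ < 3 := by
          rw [norm_smul, e, Real.norm_eq_abs, mul_one]
          have : |x.2| ≤ 1 := by rw [abs_le]; constructor <;> linarith [hx.2.1, hx.2.2]
          linarith
  refine le_antisymm measureReal_le_one ?_
  calc (1:ℝ) = (shiftP.map (Tm k i)).real (ball (toPlane p) 3) := by rw [measureReal_def, h2]; simp
    _ ≤ _ := measureReal_mono hs

lemma core_energy_aux (k : Fin 2) (e : ℤ × ℤ) (he : ∀ i, toPlane (i + e) - ev k = toPlane i)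
    (E VF : Finset (ℤ × ℤ)) (α : ℤ × ℤ → ℝ)
    (hV : ∀ p ∈ VF, p ∈ E ∧ p + e ∈ E) (s : Set Plane) (hs : ∀ p ∈ VF, ball (toPlane p) 3 ⊆ s) :
    ∑ p ∈ VF, (α p ^ 2 + α (p + e) ^ 2) ≤ 2 * (nuk k E α).real s := by
  rw [nuk_real, Finset.sum_add_distrib, two_mul]
  have hnn : ∀ i, 0 ≤ α i ^ 2 * (shiftP.map (Tm k i)).real s := fun i => by positivity
  refine add_le_add ?_ ?_
  · calc ∑ p ∈ VF, α p ^ 2 = ∑ p ∈ VF, α p ^ 2 * (shiftP.map (Tm k p)).real s := by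
          refine Finset.sum_congr rfl fun p hp => ?_
          rw [Tm_core k p p s (hs p hp) (Or.inl (by simp)), mul_one]
      _ ≤ _ := Finset.sum_le_sum_of_subset_of_nonneg (fun p hp => (hV p hp).1) fun i _ _ => hnn i
  · calc ∑ p ∈ VF, α (p + e) ^ 2
          = ∑ p ∈ VF, α (p + e) ^ 2 * (shiftP.map (Tm k (p + e))).real s := by
          refine Finset.sum_congr rfl fun p hp => ?_
          rw [Tm_core k p (p + e) s (hs p hp) (Or.inr (he p)), mul_one]
      _ = ∑ i ∈ VF.image (· + e), α i ^ 2 * (shiftP.map (Tm k i)).real s := by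
          rw [Finset.sum_image (fun a _ b _ h => add_right_cancel h)]
      _ ≤ _ := Finset.sum_le_sum_of_subset_of_nonneg (fun i hi => by
          obtain ⟨p, hp, rfl⟩ := Finset.mem_image.1 hi
          exact (hV p hp).2) fun i _ _ => hnn i

lemma core_energy (E₀ E₁ VF : Finset (ℤ × ℤ)) (α₀ α₁ : ℤ × ℤ → ℝ)
    (hV : ∀ p ∈ VF, p ∈ E₀ ∧ p + (0,1) ∈ E₀ ∧ p ∈ E₁ ∧ p + (1,0) ∈ E₁ ∧ 1 ≤ |circ α₀ α₁ p|)
    (s : Set Plane) (hs : ∀ p ∈ VF, ball (toPlane p) 3 ⊆ s) :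
    (VF.card : ℝ) / 8 ≤ (nuk 1 E₀ α₀ + nuk 0 E₁ α₁).real s := by
  rw [measureReal_add_apply]
  have h0 := core_energy_aux 1 (0,1) (fun i => by
    rw [← toPlane_sub_e1]; simp) E₀ VF α₀ (fun p hp => ⟨(hV p hp).1, (hV p hp).2.1⟩) s hs
  have h1 := core_energy_aux 0 (1,0) (fun i => by
    rw [← toPlane_sub_e0]; simp) E₁ VF α₁ (fun p hp => ⟨(hV p hp).2.2.1, (hV p hp).2.2.2.1⟩) s hs
  have h2 : (VF.card : ℝ) * (1/4) ≤ ∑ p ∈ VF, ((α₀ p ^ 2 + α₀ (p + (0,1)) ^ 2)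
      + (α₁ p ^ 2 + α₁ (p + (1,0)) ^ 2)) := by
    rw [← nsmul_eq_mul]
    refine Finset.card_nsmul_le_sum _ _ _ fun p hp => ?_
    have h3 := (hV p hp).2.2.2.2
    have h4 : 1 ≤ circ α₀ α₁ p ^ 2 := by
      rw [← sq_abs]; nlinarith
    rw [circ] at h4
    set a := α₀ p
    set b := α₁ (p + (1,0))
    set c := α₀ (p + (0,1))
    set d := α₁ p
    nlinarith [sq_nonneg (a - b), sq_nonneg (a + c), sq_nonneg (a + d), sq_nonneg (b + c),
      sq_nonneg (b + d), sq_nonneg (c - d)]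
  rw [Finset.sum_add_distrib] at h2
  linarith

set_option maxHeartbeats 1000000 in
theorem lower_comb (E₀ E₁ VF : Finset (ℤ × ℤ)) (α₀ α₁ : ℤ × ℤ → ℝ) (U : Set Plane)
    (hcint : ∀ i, ∃ n : ℤ, circ α₀ α₁ i = n)
    (hU : ∀ i, (∃ y ∈ Q0, toPlane i + y ∈ U) → i ∈ E₀ ∧ i + (0,1) ∈ E₀ ∧ i ∈ E₁ ∧ i + (1,0) ∈ E₁ ∧
      (circ α₀ α₁ i ≠ 0 → i ∈ VF))
    (hV : ∀ p ∈ VF, p ∈ E₀ ∧ p + (0,1) ∈ E₀ ∧ p ∈ E₁ ∧ p + (1,0) ∈ E₁ ∧ circ α₀ α₁ p ≠ 0)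
    (t : ℝ) (ht : 0 ≤ t) :
    ∃ (J : Finset VF) (c : VF → Plane) (r : VF → ℝ) (f : VF → VF),
      (∀ p, f p ∈ J) ∧ (∀ j ∈ J, 0 < r j) ∧
      (∀ p : VF, ball (toPlane p) 3 ⊆ ball (c (f p)) (r (f p))) ∧
      (∑ j ∈ J, r j ≤ Real.exp t * (3 * VF.card)) ∧
      (VF.card : ℝ) / 8 + 1 / (2 * Real.pi) * t *
        (∑ j ∈ J with ball (c j) (r j) ⊆ U, |∑ p with f p = j, circ α₀ α₁ p|)
        ≤ ∑ i ∈ E₀, α₀ i ^ 2 + ∑ i ∈ E₁, α₁ i ^ 2 := by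
  have hA := annProp E₀ E₁ VF α₀ α₁ U hcint hU
  set ν := nuk 1 E₀ α₀ + nuk 0 E₁ α₁ with hν
  obtain ⟨J, c, r, f, h1, h2, h3, h4, h5, h6⟩ := ball_construction ν U (1 / (2 * Real.pi))
    (by positivity) _ _ _ hA _ Finset.univ (fun p : VF => toPlane p) (fun _ => 3) id t rfl ht
    (by simp) (by simp) (fun p => subset_rfl)
  refine ⟨J, c, r, f, by simpa using h1, h2, by simpa using h3, ?_, ?_⟩
  · refine h4.trans (le_of_eq ?_)
    simp; ring
  · set C : Set Plane := ⋃ i ∈ (Finset.univ : Finset VF), ball (toPlane i) 3 with hC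
    have hCm : MeasurableSet C :=
      Finset.measurableSet_biUnion _ fun i _ => measurableSet_ball
    have hcore : (VF.card : ℝ) / 8 ≤ ν.real C := by
      refine core_energy E₀ E₁ VF α₀ α₁ (fun p hp => ?_) C fun p hp => ?_
      · obtain ⟨a, b, c, d, e⟩ := hV p hp
        refine ⟨a, b, c, d, ?_⟩
        obtain ⟨n, hn⟩ := hcint p
        rw [hn] at e ⊢
        have : n ≠ 0 := by exact_mod_cast e
        exact_mod_cast Int.one_le_abs this
      · intro z hz
        rw [hC]
        simp only [Set.mem_iUnion]
        exact ⟨⟨p, hp⟩, Finset.mem_univ _, hz⟩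
    have htot : ν.real Set.univ = ∑ i ∈ E₀, α₀ i ^ 2 + ∑ i ∈ E₁, α₁ i ^ 2 := by
      rw [hν, measureReal_add_apply, nuk_real, nuk_real]
      simp
    rw [← htot]
    have hsum : 1 / (2 * Real.pi) * t *
        (∑ j ∈ J with ball (c j) (r j) ⊆ U, |∑ p with f p = j, circ α₀ α₁ p|) ≤
        ν.real (⋃ j ∈ (J.filter fun j => ball (c j) (r j) ⊆ U), (ball (c j) (r j) \ C)) := by
      rw [measureReal_biUnion_finset]
      · rw [Finset.mul_sum]
        refine Finset.sum_le_sum fun j hj => ?_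
        rw [Finset.mem_filter] at hj
        have h7 := h6 j hj.1 hj.2
        refine le_trans (le_of_eq ?_) h7
        refine congrArg (fun z => 1 / (2 * Real.pi) * t * |z|) ?_
        refine Finset.sum_congr ?_ fun _ _ => rfl
        ext p
        simp only [Finset.mem_filter, id]
      · intro i hi j hj hij
        exact (h5 i (Finset.mem_filter.1 hi).1 j (Finset.mem_filter.1 hj).1 hij).mono
          Set.sdiff_subset Set.sdiff_subset
      · exact fun j _ => measurableSet_ball.diff hCm
    set D := (⋃ j ∈ (J.filter fun j => ball (c j) (r j) ⊆ U), (ball (c j) (r j) \ C))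
    have hD : D ⊆ Cᶜ := Set.iUnion₂_subset fun j _ z hz => hz.2
    have := measureReal_mono (μ := ν) hD
    have h7 := measureReal_add_measureReal_compl (μ := ν) hCm
    linarith

lemma cutoff {V : Type} (J : Finset V) (c : V → Plane) (R : V → ℝ) (x : Plane) (σ : ℝ) (hσ : 0 < σ)
    (hR : ∀ j ∈ J, 0 < R j) (hsum : ∑ j ∈ J, R j ≤ σ / 8) :
    ∃ ψ : Plane → ℝ, LipschitzWith 1 ψ ∧ (∀ z, 0 ≤ ψ z ∧ ψ z ≤ min 1 (σ / 4)) ∧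
      ψ x = min 1 (σ / 4) ∧ (∀ z, σ / 2 ≤ dist z x → ψ z = 0) ∧
      ∀ j ∈ J, ∀ z ∈ ball (c j) (R j), ψ z = ψ (c j) := by
  set K : Set ℝ := ⋃ j ∈ J, Set.Icc (dist (c j) x - R j) (dist (c j) x + R j) with hK
  have hKm : MeasurableSet K := Finset.measurableSet_biUnion _ fun _ _ => measurableSet_Icc
  have hfin : ∀ a b : ℝ, volume (Set.Ioc a b \ K) ≠ ⊤ := fun a b =>
    ((measure_mono Set.sdiff_subset).trans_lt (by simp [Real.volume_Ioc])).ne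
  set g : ℝ → ℝ := fun s => volume.real (Set.Ioc 0 s \ K) with hg
  have hsplit : ∀ s s', 0 ≤ s → s ≤ s' → g s' = g s + volume.real (Set.Ioc s s' \ K) := by
    intro s s' h0 h
    rw [hg]
    simp only
    rw [← measureReal_union _ (measurableSet_Ioc.diff hKm) (hfin _ _) (hfin _ _),
      ← Set.union_sdiff_distrib, Set.Ioc_union_Ioc_eq_Ioc h0 h]
    refine Disjoint.mono Set.sdiff_subset Set.sdiff_subset ?_
    rw [Set.disjoint_left]
    intro a ha hb
    exact absurd ha.2 (not_le.2 hb.1)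
  have hlip : ∀ s s', 0 ≤ s → s ≤ s' → g s ≤ g s' ∧ g s' ≤ g s + (s' - s) := by
    intro s s' h0 h
    rw [hsplit s s' h0 h]
    refine ⟨le_add_of_nonneg_right measureReal_nonneg, add_le_add_right ?_ _⟩
    calc volume.real (Set.Ioc s s' \ K) ≤ volume.real (Set.Ioc s s') :=
          measureReal_mono Set.sdiff_subset (by simp [Real.volume_Ioc])
      _ = s' - s := by rw [Real.volume_real_Ioc_of_le h]
  have hlip2 : ∀ s s', 0 ≤ s → 0 ≤ s' → |g s - g s'| ≤ |s - s'| := by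
    intro s s' h0 h0'
    rcases le_total s s' with h | h
    · have := hlip s s' h0 h
      rw [abs_sub_comm, abs_sub_comm s, abs_of_nonneg (by linarith), abs_of_nonneg (by linarith)]
      linarith
    · have := hlip s' s h0' h
      rw [abs_of_nonneg (by linarith), abs_of_nonneg (by linarith)]
      linarith
  have hKvol : volume K ≤ ENNReal.ofReal (σ / 4) := by
    calc volume K ≤ ∑ j ∈ J, volume (Set.Icc (dist (c j) x - R j) (dist (c j) x + R j)) :=
          measure_biUnion_finset_le _ _
      _ = ∑ j ∈ J, ENNReal.ofReal (2 * R j) := by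
          refine Finset.sum_congr rfl fun j _ => ?_
          rw [Real.volume_Icc]; congr 1; ring
      _ = ENNReal.ofReal (∑ j ∈ J, 2 * R j) := by
          rw [ENNReal.ofReal_sum_of_nonneg fun j hj => by linarith [hR j hj]]
      _ ≤ _ := ENNReal.ofReal_le_ofReal (by rw [← Finset.mul_sum]; linarith)
  have hKreal : volume.real K ≤ σ / 4 := by
    rw [measureReal_def]
    exact ENNReal.toReal_le_of_le_ofReal (by positivity) hKvol
  have hKfin : volume K ≠ ⊤ := (hKvol.trans_lt ENNReal.ofReal_lt_top).ne
  have hghalf : σ / 4 ≤ g (σ / 2) := by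
    have h1 : volume.real (Set.Ioc 0 (σ / 2)) ≤ volume.real (Set.Ioc 0 (σ/2) \ K) + volume.real K := by
      refine (measureReal_mono (s₂ := (Set.Ioc 0 (σ/2) \ K) ∪ K) ?_ ?_).trans (measureReal_union_le _ _)
      · intro a ha
        by_cases hk : a ∈ K
        · exact Or.inr hk
        · exact Or.inl ⟨ha, hk⟩
      · exact (measure_union_lt_top (hfin _ _).lt_top hKfin.lt_top).ne
    rw [Real.volume_real_Ioc_of_le (by positivity)] at h1
    simp only [hg]; linarith
  have hg0 : g 0 = 0 := by simp [hg]
  have hgnn : ∀ s, 0 ≤ g s := fun s => measureReal_nonneg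
  set m := min 1 (σ / 4) with hm
  have hmpos : 0 ≤ m := le_min zero_le_one (by positivity)
  refine ⟨fun z => max 0 (m - g (dist z x)), ?_, ?_, ?_, ?_, ?_⟩
  · refine LipschitzWith.of_dist_le_mul fun z z' => ?_
    rw [Real.dist_eq, NNReal.coe_one, one_mul]
    calc |max 0 (m - g (dist z x)) - max 0 (m - g (dist z' x))|
        ≤ |(m - g (dist z x)) - (m - g (dist z' x))| := by
          rw [max_comm 0, max_comm 0]; exact abs_max_sub_max_le_abs _ _ _
      _ = |g (dist z' x) - g (dist z x)| := by congr 1; ring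
      _ ≤ |dist z' x - dist z x| := hlip2 _ _ dist_nonneg dist_nonneg
      _ ≤ dist z' z := abs_dist_sub_le _ _ _
      _ = dist z z' := dist_comm _ _
  · exact fun z => ⟨le_max_left _ _, max_le hmpos (by linarith [hgnn (dist z x)])⟩
  · simp [hg0, hmpos]
  · intro z hz
    have := (hlip (σ/2) (dist z x) (by positivity) hz).1
    refine max_eq_left ?_
    have : m ≤ σ / 4 := min_le_right _ _
    linarith
  · intro j hj z hz
    have key : ∀ s s', 0 ≤ s → s ≤ s' → s ∈ Set.Icc (dist (c j) x - R j) (dist (c j) x + R j) →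
        s' ∈ Set.Icc (dist (c j) x - R j) (dist (c j) x + R j) → g s = g s' := by
      intro s s' h0 h h1 h2
      rw [hsplit s s' h0 h]
      have : Set.Ioc s s' \ K = ∅ := by
        rw [Set.sdiff_eq_empty]
        intro a ha
        simp only [hK, Set.mem_iUnion]
        exact ⟨j, hj, h1.1.trans ha.1.le, ha.2.trans h2.2⟩
      rw [this]; simp
    have hz' : |dist z x - dist (c j) x| ≤ R j :=
      (abs_dist_sub_le _ _ _).trans (mem_ball.1 hz).le
    rw [abs_le] at hz'
    have h1 : dist z x ∈ Set.Icc (dist (c j) x - R j) (dist (c j) x + R j) :=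
      ⟨by linarith, by linarith⟩
    have h2 : dist (c j) x ∈ Set.Icc (dist (c j) x - R j) (dist (c j) x + R j) :=
      ⟨by linarith [hR j hj], by linarith [hR j hj]⟩
    have : g (dist z x) = g (dist (c j) x) := by
      rcases le_total (dist z x) (dist (c j) x) with h | h
      · exact key _ _ dist_nonneg h h1 h2
      · exact (key _ _ dist_nonneg h h2 h1).symm
    simp only [this]

lemma mollify (ψ : Plane → ℝ) (hψ : LipschitzWith 1 ψ) (hb : ∀ z, |ψ z| ≤ 1) (x : Plane) (σ : ℝ)
    (hσ : 0 < σ) (hs : ∀ z, σ / 2 ≤ dist z x → ψ z = 0) (δ : ℝ) (hδ : 0 < δ) (hδσ : δ ≤ σ / 4) :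
    ∃ φ : Plane → ℝ, ContDiff ℝ (⊤ : ℕ∞) φ ∧ HasCompactSupport φ ∧ tsupport φ ⊆ ball x σ ∧
      (∀ p, |φ p| ≤ 1) ∧ (∀ p, ‖fderiv ℝ φ p‖ ≤ 1) ∧ ∀ p, |φ p - ψ p| ≤ δ := by
  let b : ContDiffBump (0 : Plane) := ⟨δ / 2, δ, by positivity, by linarith⟩
  set B := b.normed volume with hB
  have hBc : Continuous B := b.continuous_normed
  have hBs : HasCompactSupport B := b.hasCompactSupport_normed
  have hBnn : ∀ z, 0 ≤ B z := fun z => b.nonneg_normed z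
  have hBi : ∫ z, B z = 1 := b.integral_normed
  have hBint : Integrable B := hBc.integrable_of_hasCompactSupport hBs
  set φ : Plane → ℝ := fun z => ∫ t, B t * ψ (z - t) with hφ
  have hconv : φ = MeasureTheory.convolution B ψ (ContinuousLinearMap.lsmul ℝ ℝ) volume := by
    ext z; simp [hφ, MeasureTheory.convolution]
  have hI : ∀ z, Integrable (fun t => B t * ψ (z - t)) := by
    intro z
    refine Continuous.integrable_of_hasCompactSupport ?_ hBs.mul_right
    exact hBc.mul (hψ.continuous.comp (continuous_const.sub continuous_id))
  have hlip : LipschitzWith 1 φ := by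
    refine LipschitzWith.of_dist_le_mul fun z z' => ?_
    rw [Real.dist_eq, NNReal.coe_one, one_mul]
    simp only [hφ]
    rw [← integral_sub (hI z) (hI z')]
    calc |∫ t, (B t * ψ (z - t) - B t * ψ (z' - t))|
        ≤ ∫ t, B t * dist z z' := by
          rw [← Real.norm_eq_abs]
          refine norm_integral_le_of_norm_le (hBint.mul_const _) (Filter.Eventually.of_forall fun t => ?_)
          rw [← mul_sub, Real.norm_eq_abs, abs_mul, abs_of_nonneg (hBnn t)]
          refine mul_le_mul_of_nonneg_left ?_ (hBnn t)
          have := hψ.dist_le_mul (z - t) (z' - t)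
          rwa [Real.dist_eq, NNReal.coe_one, one_mul, dist_sub_right] at this
      _ = dist z z' := by rw [integral_mul_const, hBi, one_mul]
  have hsupp : ∀ z, φ z ≠ 0 → dist z x ≤ σ * (3 / 4) := by
    intro z hz
    by_contra hcon
    push Not at hcon
    apply hz
    simp only [hφ]
    refine integral_eq_zero_of_ae (Filter.Eventually.of_forall fun t => ?_)
    simp only [Pi.zero_apply]
    by_cases ht : t ∈ ball (0 : Plane) δ
    · rw [hs, mul_zero]
      have h1 : dist z x ≤ dist (z - t) x + ‖t‖ := by
        have := dist_triangle z (z - t) x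
        rw [dist_eq_norm z (z - t), sub_sub_cancel] at this
        linarith
      rw [mem_ball_zero_iff] at ht
      linarith
    · have : B t = 0 := by
        rw [← Function.notMem_support, hB, b.support_normed_eq]
        exact ht
      rw [this, zero_mul]
  have hts : tsupport φ ⊆ closedBall x (σ * (3 / 4)) :=
    closure_minimal (fun z hz => hsupp z hz) isClosed_closedBall
  refine ⟨φ, ?_, ?_, ?_, ?_, ?_, ?_⟩
  · rw [hconv]
    exact hBs.contDiff_convolution_left _ b.contDiff_normed hψ.continuous.locallyIntegrable
  · exact HasCompactSupport.of_support_subset_isCompact (isCompact_closedBall x (σ * (3/4)))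
      (fun z hz => hsupp z hz)
  · exact hts.trans (closedBall_subset_ball (by linarith))
  · intro p
    simp only [hφ]
    calc |∫ t, B t * ψ (p - t)| ≤ ∫ t, B t := by
          rw [← Real.norm_eq_abs]
          refine norm_integral_le_of_norm_le hBint (Filter.Eventually.of_forall fun t => ?_)
          rw [Real.norm_eq_abs, abs_mul, abs_of_nonneg (hBnn t)]
          nlinarith [hBnn t, hb (p - t)]
      _ = 1 := hBi
  · intro p
    simpa using norm_fderiv_le_of_lipschitz ℝ hlip (x₀ := p)
  · intro p
    rw [hconv, ← Real.dist_eq]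
    refine b.dist_normed_convolution_le hψ.continuous.aestronglyMeasurable fun z hz => ?_
    have := hψ.dist_le_mul z p
    rw [NNReal.coe_one, one_mul] at this
    exact this.trans (mem_ball.1 hz).le

lemma flat_ge (Ω : Set Plane) (T : Plane → ℝ) (hT : (Function.support T).Finite)
    (ψ : Plane → ℝ) (hψ : LipschitzWith 1 ψ) (hb : ∀ z, |ψ z| ≤ 1) (x : Plane) (σ : ℝ)
    (hσ : 0 < σ) (hs : ∀ z, σ / 2 ≤ dist z x → ψ z = 0) (hΩ : ball x σ ⊆ Ω) :
    ∑ p ∈ hT.toFinset, T p * ψ p ≤ flatNorm Ω T := by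
  have hfs : ∀ φ : Plane → ℝ, ∑ᶠ p, T p * φ p = ∑ p ∈ hT.toFinset, T p * φ p := by
    intro φ
    refine finsum_eq_sum_of_support_subset _ ?_
    intro p hp
    simp only [Set.Finite.coe_toFinset, Function.mem_support]
    intro h0
    exact hp (by simp [h0])
  have hbdd : BddAbove {r : ℝ | ∃ ψ : Plane → ℝ, ContDiff ℝ (⊤ : ℕ∞) ψ ∧ HasCompactSupport ψ ∧
      tsupport ψ ⊆ Ω ∧ (∀ p, |ψ p| ≤ 1) ∧ (∀ p, ‖fderiv ℝ ψ p‖ ≤ 1) ∧ r = ∑ᶠ p, T p * ψ p} := by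
    refine ⟨∑ p ∈ hT.toFinset, |T p|, ?_⟩
    rintro r ⟨φ, -, -, -, h1, -, rfl⟩
    rw [hfs]
    refine Finset.sum_le_sum fun p _ => (le_abs_self _).trans ?_
    rw [abs_mul]
    nlinarith [abs_nonneg (T p), h1 p]
  set A := ∑ p ∈ hT.toFinset, |T p| with hA
  have hA0 : 0 ≤ A := Finset.sum_nonneg fun _ _ => abs_nonneg _
  have key : ∀ δ, 0 < δ → δ ≤ σ / 4 → ∑ p ∈ hT.toFinset, T p * ψ p ≤ flatNorm Ω T + δ * A := by
    intro δ h0 h1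
    obtain ⟨φ, p1, p2, p3, p4, p5, p6⟩ := mollify ψ hψ hb x σ hσ hs δ h0 h1
    have h2 : ∑ p ∈ hT.toFinset, T p * φ p ≤ flatNorm Ω T :=
      le_csSup hbdd ⟨φ, p1, p2, p3.trans hΩ, p4, p5, (hfs φ).symm⟩
    have h3 : ∑ p ∈ hT.toFinset, T p * ψ p ≤ ∑ p ∈ hT.toFinset, (T p * φ p + δ * |T p|) := by
      refine Finset.sum_le_sum fun p _ => ?_
      have h4 : T p * (ψ p - φ p) ≤ |T p| * δ := by
        refine (le_abs_self _).trans ?_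
        rw [abs_mul, abs_sub_comm]
        exact mul_le_mul_of_nonneg_left (p6 p) (abs_nonneg _)
      linarith
    rw [Finset.sum_add_distrib, ← Finset.mul_sum] at h3
    linarith
  by_contra hcon
  push Not at hcon
  set gap := ∑ p ∈ hT.toFinset, T p * ψ p - flatNorm Ω T with hgap
  have hg : 0 < gap := by linarith
  have h5 := key (min (σ / 4) (gap / (2 * (A + 1)))) (lt_min (by positivity) (by positivity)) (min_le_left _ _)
  have h6 : min (σ / 4) (gap / (2 * (A + 1))) * A ≤ gap / 2 := by
    calc _ ≤ gap / (2 * (A + 1)) * (A + 1) := by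
          refine mul_le_mul (min_le_right _ _) (by linarith) hA0 (by positivity)
      _ = gap / 2 := by field_simp
  linarith

lemma toPlane_add (i e : ℤ × ℤ) : toPlane (i + e) = toPlane i + toPlane e := by
  ext k; fin_cases k <;> simp [toPlane]

lemma toPlane_norm_le (e : ℤ × ℤ) (h1 : |e.1| ≤ 1) (h2 : |e.2| ≤ 1) : ‖toPlane e‖ ≤ 3 / 2 := by
  have h := plane_norm_sq (toPlane e)
  simp only [toPlane_zero, toPlane_one] at h
  have h1' : |(e.1 : ℝ)| ≤ 1 := by exact_mod_cast h1
  have h2' : |(e.2 : ℝ)| ≤ 1 := by exact_mod_cast h2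
  have : (e.1 : ℝ) ^ 2 ≤ 1 := by rw [← sq_abs]; nlinarith [abs_nonneg (e.1 : ℝ)]
  have : (e.2 : ℝ) ^ 2 ≤ 1 := by rw [← sq_abs]; nlinarith [abs_nonneg (e.2 : ℝ)]
  nlinarith [norm_nonneg (toPlane e)]

/-- the vector (1/2,1/2) -/
noncomputable def hv : Plane := !₂[1/2, 1/2]

lemma hv_norm : ‖hv‖ ≤ 1 := by
  have h := plane_norm_sq hv
  simp [hv] at h
  simp only [hv]
  nlinarith [norm_nonneg hv, norm_nonneg (!₂[1/2, 1/2] : Plane)]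

lemma center_eq (ε : ℝ) (i : ℤ × ℤ) : center ε i = ε • (toPlane i + hv) := by
  ext k; fin_cases k <;> simp [center, toPlane, hv] <;> ring

lemma lat_finite (X : Plane) (S : ℝ) : {i : ℤ × ℤ | toPlane i ∈ ball X S}.Finite := by
  obtain ⟨k, hk⟩ := exists_nat_ge (‖X‖ + S)
  refine (Set.finite_Icc ((-k, -k) : ℤ × ℤ) ((k, k) : ℤ × ℤ)).subset fun i hi => ?_
  have hi' : ‖toPlane i‖ ≤ k := by
    have h1 : ‖toPlane i - X‖ < S := by rw [← dist_eq_norm]; exact hi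
    have := norm_le_norm_add_norm_sub' (toPlane i) X
    linarith
  have h0 := (plane_abs_le (toPlane i) 0).trans hi'
  have h1 := (plane_abs_le (toPlane i) 1).trans hi'
  simp only [toPlane_zero, toPlane_one] at h0 h1
  have h0' : |i.1| ≤ (k : ℤ) := by exact_mod_cast h0
  have h1' : |i.2| ≤ (k : ℤ) := by exact_mod_cast h1
  rw [abs_le] at h0' h1'
  exact ⟨⟨h0'.1, h1'.1⟩, ⟨h0'.2, h1'.2⟩⟩

lemma smul_mem_ball (ε : ℝ) (hε : 0 < ε) (x z : Plane) (σ : ℝ) :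
    ε • z ∈ ball x σ ↔ z ∈ ball (ε⁻¹ • x) (σ / ε) := by
  rw [mem_ball, mem_ball, dist_eq_norm, dist_eq_norm, lt_div_iff₀ hε]
  have : ε • z - x = ε • (z - ε⁻¹ • x) := by
    rw [smul_sub, smul_smul, mul_inv_cancel₀ hε.ne', one_smul]
  rw [this, norm_smul, Real.norm_eq_abs, abs_of_pos hε, mul_comm]

lemma smul_dist (ε : ℝ) (hε : 0 < ε) (x z : Plane) :
    dist (ε • z) x = ε * dist z (ε⁻¹ • x) := by
  rw [dist_eq_norm, dist_eq_norm]
  have : ε • z - x = ε • (z - ε⁻¹ • x) := by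
    rw [smul_sub, smul_smul, mul_inv_cancel₀ hε.ne', one_smul]
  rw [this, norm_smul, Real.norm_eq_abs, abs_of_pos hε]

lemma center_injective (ε : ℝ) (hε : 0 < ε) : Function.Injective (center ε) := by
  intro i j h
  rw [center_eq, center_eq] at h
  have h1 := smul_right_injective Plane hε.ne' h
  have h2 : toPlane i = toPlane j := add_right_cancel h1
  have h3 := congrArg (fun z : Plane => z 0) h2
  have h4 := congrArg (fun z : Plane => z 1) h2
  simp only [toPlane_zero, toPlane_one] at h3 h4
  exact Prod.ext (by exact_mod_cast h3) (by exact_mod_cast h4)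

lemma centers_finite (ε : ℝ) (hε : 0 < ε) (Ω : Set Plane) (hΩ : Bornology.IsBounded Ω) :
    {i : ℤ × ℤ | center ε i ∈ Ω}.Finite := by
  obtain ⟨R, hR⟩ := hΩ.subset_ball (0 : Plane)
  refine (lat_finite (ε⁻¹ • 0 - hv) (R / ε)).subset fun i hi => ?_
  have := hR hi
  rw [center_eq, smul_mem_ball ε hε, mem_ball, dist_eq_norm] at this
  simp only [Set.mem_ofPred_eq, mem_ball, dist_eq_norm]
  convert! this using 2
  abel

lemma elast_circ_int (u : ℤ × ℤ → ℝ) (i : ℤ × ℤ) :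
    ∃ n : ℤ, circ (fun i => elast (u (i + (1,0)) - u i)) (fun i => elast (u (i + (0,1)) - u i)) i = n := by
  simp only [circ, elast]
  have : i + (1,0) + (0,1) = i + (0,1) + (1,0) := by abel
  rw [this]
  refine ⟨- ⌈u (i + (1,0)) - u i - 1/2⌉ - ⌈u (i + (0,1) + (1,0)) - u (i + (1,0)) - 1/2⌉
    + ⌈u (i + (0,1) + (1,0)) - u (i + (0,1)) - 1/2⌉ + ⌈u (i + (0,1)) - u i - 1/2⌉, ?_⟩
  push_cast
  ring

lemma mCirc_eq (u : ℤ × ℤ → ℝ) (i : ℤ × ℤ) : mCirc u i =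
    circ (fun i => elast (u (i + (1,0)) - u i)) (fun i => elast (u (i + (0,1)) - u i)) i := by
  simp only [circ, mCirc]
  have h1 : i + (1,0) + (0,1) = i + (1,1) := by ext <;> simp
  have h2 : i + (0,1) + (1,0) = i + (1,1) := by ext <;> simp
  rw [h1, h2]

/-- testing the vorticity against a cut-off -/
lemma flat_test (Ω : Set Plane) (hΩb : Bornology.IsBounded Ω) (ε : ℝ) (hε : 0 < ε)
    (u : ℤ × ℤ → ℝ) (N : ℕ) (d : Fin N → ℤ) (x : Fin N → Plane) (h : Fin N) (σ : ℝ) (hσ : 0 < σ)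
    (hball : ball (x h) σ ⊆ Ω) (hout : ∀ h', h' ≠ h → σ ≤ dist (x h') (x h))
    (ψ : Plane → ℝ) (hψ : LipschitzWith 1 ψ) (hb : ∀ z, |ψ z| ≤ 1)
    (hs : ∀ z, σ / 2 ≤ dist z (x h) → ψ z = 0) :
    |∑ i ∈ (centers_finite ε hε Ω hΩb).toFinset, mCirc u i * ψ (center ε i) - d h * ψ (x h)| ≤
      flatNorm Ω (fun p => vortMeas ε u Ω p - ∑ h, if x h = p then (d h : ℝ) else 0) := by
  set I := (centers_finite ε hε Ω hΩb).toFinset with hI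
  set T : Plane → ℝ := fun p => vortMeas ε u Ω p - ∑ h, if x h = p then (d h : ℝ) else 0 with hTdef
  have hv1 : ∀ p, vortMeas ε u Ω p = ∑ i ∈ I, if center ε i = p then mCirc u i else 0 := by
    intro p
    simp only [vortMeas]
    rw [finsum_eq_sum_of_support_subset (s := I)]
    · refine Finset.sum_congr rfl fun i hi => ?_
      have hi' : center ε i ∈ Ω := by simpa [hI] using hi
      simp only [hi', and_true]
      rw [finsum_eq_if]
    · intro i hi
      have : center ε i = p ∧ center ε i ∈ Ω := by
        by_contra hcon
        apply hi
        beta_reduce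
        rw [finsum_eq_if, if_neg hcon]
      simpa [hI] using this.2
  set P : Finset Plane := I.image (center ε) ∪ Finset.univ.image x with hP
  have hsub : Function.support T ⊆ P := by
    intro p hp
    by_contra hcon
    apply hp
    simp only [hP, Finset.coe_union, Set.mem_union, not_or, Finset.mem_coe, Finset.mem_image,
      not_exists, not_and] at hcon
    simp only [hTdef, hv1]
    rw [Finset.sum_eq_zero, Finset.sum_eq_zero, sub_zero]
    · exact fun k _ => if_neg (hcon.2 k (Finset.mem_univ _))
    · exact fun i hi => if_neg (hcon.1 i hi)
  have hT : (Function.support T).Finite := P.finite_toSet.subset hsub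
  have hval : ∀ φ : Plane → ℝ, (∀ z, σ / 2 ≤ dist z (x h) → φ z = 0) →
      ∑ p ∈ hT.toFinset, T p * φ p = ∑ i ∈ I, mCirc u i * φ (center ε i) - d h * φ (x h) := by
    intro φ hφ
    rw [Finset.sum_subset (s₂ := P)]
    · simp only [hTdef, hv1, sub_mul, Finset.sum_sub_distrib, Finset.sum_mul]
      congr 1
      · rw [Finset.sum_comm]
        refine Finset.sum_congr rfl fun i hi => ?_
        simp only [ite_mul, zero_mul]
        rw [Finset.sum_ite_eq, if_pos]
        exact Finset.mem_union_left _ (Finset.mem_image_of_mem _ hi)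
      · rw [Finset.sum_comm]
        rw [Finset.sum_eq_single h]
        · simp only [ite_mul, zero_mul]
          rw [Finset.sum_ite_eq, if_pos]
          exact Finset.mem_union_right _ (Finset.mem_image_of_mem _ (Finset.mem_univ _))
        · intro k _ hk
          simp only [ite_mul, zero_mul]
          rw [Finset.sum_ite_eq]
          rw [hφ (x k) (by linarith [hout k hk]), mul_zero, ite_self]
        · simp
    · intro p hp
      exact hsub (by simpa using hp)
    · intro p _ hp
      have : T p = 0 := by simpa using hp
      rw [this, zero_mul]
  have h1 := flat_ge Ω T hT ψ hψ hb (x h) σ hσ hs hball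
  have h2 := flat_ge Ω T hT (fun z => - ψ z) hψ.neg (by simpa using hb) (x h) σ hσ
    (fun z hz => by simp [hs z hz]) hball
  rw [hval ψ hs] at h1
  rw [hval _ (fun z hz => by simp [hs z hz])] at h2
  simp only [mul_neg, Finset.sum_neg_distrib] at h2
  rw [abs_le]
  constructor <;> linarith

/-- horizontal elastic increments -/
noncomputable def al0 (u : ℤ × ℤ → ℝ) (i : ℤ × ℤ) : ℝ := elast (u (i + (1,0)) - u i)
/-- vertical elastic increments -/
noncomputable def al1 (u : ℤ × ℤ → ℝ) (i : ℤ × ℤ) : ℝ := elast (u (i + (0,1)) - u i)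

/-- edges in direction `e` with both endpoints in the ball -/
noncomputable def edg (X : Plane) (S : ℝ) (e : ℤ × ℤ) : Finset (ℤ × ℤ) :=
  (lat_finite X S).toFinset.filter fun i => toPlane (i + e) ∈ ball X S

lemma mem_edg (X : Plane) (S : ℝ) (e i : ℤ × ℤ) :
    i ∈ edg X S e ↔ toPlane i ∈ ball X S ∧ toPlane (i + e) ∈ ball X S := by
  simp [edg]

/-- vortices well inside the ball -/
noncomputable def vor (u : ℤ × ℤ → ℝ) (X : Plane) (S : ℝ) : Finset (ℤ × ℤ) :=
  (lat_finite X (S - 2)).toFinset.filter fun i => circ (al0 u) (al1 u) i ≠ 0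

lemma mem_vor (u : ℤ × ℤ → ℝ) (X : Plane) (S : ℝ) (i : ℤ × ℤ) :
    i ∈ vor u X S ↔ toPlane i ∈ ball X (S - 2) ∧ circ (al0 u) (al1 u) i ≠ 0 := by
  simp [vor]

lemma near_edges (X : Plane) (S : ℝ) (i : ℤ × ℤ) (hi : toPlane i ∈ ball X (S - 2)) :
    i ∈ edg X S (1,0) ∧ i + (0,1) ∈ edg X S (1,0) ∧ i ∈ edg X S (0,1) ∧ i + (1,0) ∈ edg X S (0,1) := by
  have key : ∀ e : ℤ × ℤ, |e.1| ≤ 1 → |e.2| ≤ 1 → toPlane (i + e) ∈ ball X S := by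
    intro e h1 h2
    have h3 := toPlane_norm_le e h1 h2
    rw [mem_ball] at hi ⊢
    rw [toPlane_add]
    calc dist (toPlane i + toPlane e) X ≤ dist (toPlane i + toPlane e) (toPlane i) + dist (toPlane i) X :=
          dist_triangle _ _ _
      _ < S := by rw [dist_eq_norm]; simp only [add_sub_cancel_left]; linarith
  have h0 : toPlane i ∈ ball X S := by simpa using key 0 (by simp) (by simp)
  have h10 := key (1,0) (by simp) (by simp)
  have h01 := key (0,1) (by simp) (by simp)
  have h11 := key (1,1) (by simp) (by simp)
  have e1 : i + (1,0) + (0,1) = i + (1,1) := by ext <;> simp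
  have e2 : i + (0,1) + (1,0) = i + (1,1) := by ext <;> simp
  simp only [mem_edg, e1, e2]
  exact ⟨⟨h0, h10⟩, ⟨h01, h11⟩, ⟨h0, h01⟩, ⟨h10, h11⟩⟩

theorem main_ball (Ω : Set Plane) (hΩb : Bornology.IsBounded Ω) (ε : ℝ) (hε : 0 < ε)
    (u : ℤ × ℤ → ℝ) (N : ℕ) (d : Fin N → ℤ) (x : Fin N → Plane) (h : Fin N) (σ : ℝ) (hσ : 0 < σ)
    (hball : ball (x h) σ ⊆ Ω) (hout : ∀ h', h' ≠ h → σ ≤ dist (x h') (x h))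
    (hεσ : 16 * ε ≤ σ)
    (hfl : flatNorm Ω (fun p => vortMeas ε u Ω p - ∑ h, if x h = p then (d h : ℝ) else 0)
      < min 1 (σ / 4)) :
    ∃ M : ℕ, (M : ℝ) / 8 + 1 / (2 * Real.pi) * Real.log (σ / ε / (24 * (M + 1))) * |(d h : ℝ)| ≤
      ∑ i ∈ edg (ε⁻¹ • x h) (σ / ε) (1,0), al0 u i ^ 2 +
      ∑ i ∈ edg (ε⁻¹ • x h) (σ / ε) (0,1), al1 u i ^ 2 := by
  set X := ε⁻¹ • x h with hX
  set S := σ / ε with hS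
  have hS16 : 16 ≤ S := by rw [hS, le_div_iff₀ hε]; exact hεσ
  set VF := vor u X S with hVF
  set t := Real.log (S / (24 * ((VF.card : ℝ) + 1))) with ht
  have hcint : ∀ i, ∃ n : ℤ, circ (al0 u) (al1 u) i = n := elast_circ_int u
  have hLC := lower_comb (edg X S (1,0)) (edg X S (0,1)) VF (al0 u) (al1 u) (ball X (S - 4)) hcint
    (by
      rintro i ⟨y, hy, hyU⟩
      have hq := Q0_norm y hy
      have hi : toPlane i ∈ ball X (S - 2) := by
        rw [mem_ball] at hyU ⊢
        calc dist (toPlane i) X ≤ dist (toPlane i) (toPlane i + y) + dist (toPlane i + y) X :=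
              dist_triangle _ _ _
          _ < S - 2 := by rw [dist_comm, dist_eq_norm]; simp only [add_sub_cancel_left]; linarith
      obtain ⟨a, b, c, e⟩ := near_edges X S i hi
      exact ⟨a, b, c, e, fun hc => (mem_vor u X S i).2 ⟨hi, hc⟩⟩)
    (by
      intro p hp
      obtain ⟨h1, h2⟩ := (mem_vor u X S p).1 hp
      obtain ⟨a, b, c, e⟩ := near_edges X S p h1
      exact ⟨a, b, c, e, h2⟩)
  refine ⟨VF.card, ?_⟩
  rcases le_or_gt 0 t with ht0 | ht0
  swap
  · obtain ⟨J, c, r, f, -, -, -, -, h5⟩ := hLC 0 le_rfl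
    simp only [mul_zero, zero_mul, add_zero] at h5
    refine le_trans ?_ h5
    have : 1 / (2 * Real.pi) * t * |(d h : ℝ)| ≤ 0 := by
      refine mul_nonpos_of_nonpos_of_nonneg ?_ (abs_nonneg _)
      exact mul_nonpos_of_nonneg_of_nonpos (by positivity) ht0.le
    linarith
  obtain ⟨J, c, r, f, h1, h2, h3, h4, h5⟩ := hLC t ht0
  refine le_trans ?_ h5
  refine add_le_add_right (mul_le_mul_of_nonneg_left ?_ (by positivity)) _
  -- radii
  have hrad : ∑ j ∈ J, r j ≤ S / 8 := by
    refine h4.trans ?_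
    rw [ht, Real.exp_log (by positivity)]
    rw [div_mul_eq_mul_div, div_le_div_iff₀ (by positivity) (by norm_num)]
    nlinarith
  obtain ⟨ψ, hψ, hψb, hψx, hψ0, hψc⟩ := cutoff J (fun j => ε • c j) (fun j => ε * r j) (x h) σ hσ
    (fun j hj => mul_pos hε (h2 j hj)) (by
      rw [← Finset.mul_sum]
      calc ε * ∑ j ∈ J, r j ≤ ε * (S / 8) := mul_le_mul_of_nonneg_left hrad hε.le
        _ = σ / 8 := by rw [hS]; field_simp)
  set m := min 1 (σ / 4) with hm
  have hm0 : 0 < m := lt_min one_pos (by positivity)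
  have hft := flat_test Ω hΩb ε hε u N d x h σ hσ hball hout ψ hψ (fun z => by
    rw [abs_of_nonneg (hψb z).1]; exact (hψb z).2.trans (min_le_left _ _)) hψ0
  rw [hψx] at hft
  have hcs : ∀ i, dist (toPlane i + hv) (toPlane i) ≤ 1 := fun i => by
    rw [dist_eq_norm]; simpa using hv_norm
  -- rewrite the sum
  have hsum1 : ∑ i ∈ (centers_finite ε hε Ω hΩb).toFinset, mCirc u i * ψ (center ε i)
      = ∑ i ∈ VF, circ (al0 u) (al1 u) i * ψ (center ε i) := by
    symm
    have hmc : ∀ i, mCirc u i = circ (al0 u) (al1 u) i := mCirc_eq u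
    simp only [hmc]
    refine Finset.sum_subset ?_ ?_
    · intro i hi
      simp only [Set.Finite.mem_toFinset, Set.mem_ofPred_eq]
      refine hball ?_
      rw [center_eq, smul_mem_ball ε hε, mem_ball]
      have := ((mem_vor u X S i).1 hi).1
      rw [mem_ball] at this
      have := dist_triangle (toPlane i + hv) (toPlane i) X
      linarith [hcs i]
    · intro i _ hi
      by_cases hc : circ (al0 u) (al1 u) i = 0
      · rw [hc, zero_mul]
      · rw [hψ0, mul_zero]
        have h6 : ¬ toPlane i ∈ ball X (S - 2) := fun h6 => hi ((mem_vor u X S i).2 ⟨h6, hc⟩)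
        rw [mem_ball, not_lt] at h6
        rw [center_eq, smul_dist ε hε]
        have := dist_triangle (toPlane i) (toPlane i + hv) X
        have h7 := hcs i
        rw [dist_comm] at h7
        have h8 : S / 2 ≤ dist (toPlane i + hv) X := by linarith
        calc σ / 2 = ε * (S / 2) := by rw [hS]; field_simp
          _ ≤ _ := mul_le_mul_of_nonneg_left h8 hε.le
  have hsum2 : ∑ i ∈ VF, circ (al0 u) (al1 u) i * ψ (center ε i)
      = ∑ j ∈ J, ψ (ε • c j) * ∑ p with f p = j, circ (al0 u) (al1 u) p := by
    rw [← Finset.sum_coe_sort VF,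
      ← Finset.sum_fiberwise_of_maps_to (s := Finset.univ) (t := J) (g := f) (fun p _ => h1 p)]
    refine Finset.sum_congr rfl fun j hj => ?_
    rw [Finset.mul_sum]
    refine Finset.sum_congr rfl fun p hp => ?_
    have hp' : f p = j := (Finset.mem_filter.1 hp).2
    rw [mul_comm, hψc j hj]
    rw [center_eq, smul_mem_ball ε hε, smul_smul, inv_mul_cancel₀ hε.ne', one_smul,
      mul_div_cancel_left₀ _ hε.ne', ← hp']
    exact h3 p (by rw [mem_ball]; linarith [hcs p])
  set D : VF → ℝ := fun j => ∑ p with f p = j, circ (al0 u) (al1 u) p with hD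
  have hsum3 : |∑ j ∈ J, ψ (ε • c j) * D j| ≤
      m * ∑ j ∈ J with ball (c j) (r j) ⊆ ball X (S - 4), |D j| := by
    rw [Finset.mul_sum, Finset.sum_filter]
    refine (Finset.abs_sum_le_sum_abs _ _).trans (Finset.sum_le_sum fun j hj => ?_)
    rw [abs_mul, abs_of_nonneg (hψb _).1]
    split_ifs with hg
    · exact mul_le_mul_of_nonneg_right (hψb _).2 (abs_nonneg _)
    · rw [hψ0, zero_mul]
      by_contra hcon
      push Not at hcon
      apply hg
      rw [smul_dist ε hε] at hcon
      have h6 : dist (c j) X < S / 2 := by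
        rw [hS, div_div, lt_div_iff₀ (by positivity)]
        linarith
      have h7 : r j ≤ S / 8 := (Finset.single_le_sum (fun k hk => (h2 k hk).le) hj).trans hrad
      refine ball_subset_ball' ?_
      linarith
  rw [hsum1, hsum2] at hft
  have hlt : |(d h : ℝ)| * m < m + m * ∑ j ∈ J with ball (c j) (r j) ⊆ ball X (S - 4), |D j| := by
    have h6 : |(d h : ℝ)| * m = |(d h : ℝ) * m| := by rw [abs_mul, abs_of_pos hm0]
    have h7 : |(d h : ℝ) * m| ≤ |∑ j ∈ J, ψ (ε • c j) * D j - d h * m| + |∑ j ∈ J, ψ (ε • c j) * D j| := by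
      have := abs_sub_abs_le_abs_sub ((d h : ℝ) * m) (∑ j ∈ J, ψ (ε • c j) * D j)
      rw [abs_sub_comm] at this
      linarith
    linarith
  have hDint : ∀ j, ∃ n : ℤ, |D j| = n := by
    intro j
    choose g hg using hcint
    refine ⟨|∑ p with f p = j, g p|, ?_⟩
    simp only [hD, hg]
    push_cast
    rfl
  choose g hg using hDint
  have hlt2 : |(d h : ℝ)| < 1 + ∑ j ∈ J with ball (c j) (r j) ⊆ ball X (S - 4), |D j| := by
    refine lt_of_mul_lt_mul_right ?_ hm0.le
    linarith
  simp only [hg] at hlt2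
  have hlt3 : |d h| < 1 + ∑ j ∈ J with ball (c j) (r j) ⊆ ball X (S - 4), g j := by exact_mod_cast hlt2
  have hle : |d h| ≤ ∑ j ∈ J with ball (c j) (r j) ⊆ ball X (S - 4), g j := by omega
  calc |(d h : ℝ)| ≤ ∑ j ∈ J with ball (c j) (r j) ⊆ ball X (S - 4), (g j : ℝ) := by exact_mod_cast hle
    _ = ∑ j ∈ J with ball (c j) (r j) ⊆ ball X (S - 4), |D j| :=
      Finset.sum_congr rfl fun j _ => (hg j).symm

lemma elast_le (t : ℝ) (n : ℤ) : |elast t| ≤ |t - n| := by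
  have h1 := Int.le_ceil (t - 1 / 2)
  have h2 := Int.ceil_lt_add_one (t - 1 / 2)
  rw [elast]
  set c := ⌈t - 1 / 2⌉
  by_cases h : n = c
  · rw [h]
  · have h3 : (1 : ℝ) ≤ |(n : ℝ) - c| := by
      exact_mod_cast Int.one_le_abs (sub_ne_zero.2 h)
    have h4 : |t - c| ≤ 1 / 2 := by rw [abs_le]; constructor <;> linarith
    have h5 : |(n : ℝ) - c| ≤ |t - c| + |t - n| := by
      have := abs_sub_le (n : ℝ) t c
      rw [abs_sub_comm (n : ℝ) t] at this
      linarith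
    linarith

lemma f0_ge (t : ℝ) : 2 * Real.pi ^ 2 * elast t ^ 2 ≤ f0 t := by
  rw [f0]
  refine mul_le_mul_of_nonneg_left ?_ (by positivity)
  rw [sq_le_sq]
  simpa using elast_le t 0

lemma f1_ge (t : ℝ) : 2 * Real.pi ^ 2 * elast t ^ 2 ≤ f1 t := by
  rw [f1]
  refine mul_le_mul_of_nonneg_left ?_ (by positivity)
  rw [← sq_abs]
  refine pow_le_pow_left₀ (abs_nonneg _) ?_ 2
  exact le_ciInf fun n => elast_le t n

lemma sum_le_tsum_sub (A : Set (ℤ × ℤ)) (E : Finset (ℤ × ℤ)) (hE : ∀ i ∈ E, i ∈ A) (a : ℤ × ℤ → ℝ)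
    (g : ℤ × ℤ → ℝ) (hag : ∀ i, 2 * Real.pi ^ 2 * a i ^ 2 ≤ g i) :
    ENNReal.ofReal (2 * Real.pi ^ 2 * ∑ i ∈ E, a i ^ 2) ≤ ∑' i : A, ENNReal.ofReal (g i) := by
  rw [tsum_subtype A (fun i => ENNReal.ofReal (g i)), Finset.mul_sum,
    ENNReal.ofReal_sum_of_nonneg fun i _ => by positivity]
  refine le_trans ?_ (ENNReal.sum_le_tsum E)
  refine Finset.sum_le_sum fun i hi => ?_
  rw [Set.indicator_of_mem (hE i hi)]
  exact ENNReal.ofReal_le_ofReal (hag i)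

lemma edg_seg (ε : ℝ) (hε : 0 < ε) (x : Plane) (σ : ℝ) (e i : ℤ × ℤ)
    (hi : i ∈ edg (ε⁻¹ • x) (σ / ε) e) : i ∈ latticeSeg ε e (ball x σ) := by
  rw [mem_edg, ← smul_mem_ball ε hε, ← smul_mem_ball ε hε] at hi
  exact (convex_ball x σ).segment_subset hi.1 hi.2

lemma Fedge_ge (ε : ℝ) (hε : 0 < ε) (u : ℤ × ℤ → ℝ) (x : Plane) (σ : ℝ) :
    ENNReal.ofReal (2 * Real.pi ^ 2 * (∑ i ∈ edg (ε⁻¹ • x) (σ / ε) (1,0), al0 u i ^ 2 +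
      ∑ i ∈ edg (ε⁻¹ • x) (σ / ε) (0,1), al1 u i ^ 2)) ≤ Fedge ε u (ball x σ) := by
  rw [mul_add]
  refine ENNReal.ofReal_add_le.trans ?_
  rw [Fedge]
  exact add_le_add
    (sum_le_tsum_sub _ _ (fun i hi => edg_seg ε hε x σ _ i hi) (al0 u)
      (fun i => f0 (u (i + (1,0)) - u i)) fun i => f0_ge _)
    (sum_le_tsum_sub _ _ (fun i hi => edg_seg ε hε x σ _ i hi) (al1 u)
      (fun i => f1 (u (i + (0,1)) - u i)) fun i => f1_ge _)

lemma log_absorb (A : ℝ) (hA : 0 ≤ A) : ∃ C : ℝ, 0 ≤ C ∧ ∀ M : ℕ,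
    Real.pi * A * (Real.log 24 + Real.log (M + 1)) ≤ Real.pi ^ 2 / 4 * M + C := by
  have hpi := Real.pi_pos
  set K := 4 * A / Real.pi + 1 with hK
  have hK0 : 0 < K := by positivity
  have h24 : 0 ≤ Real.log 24 := Real.log_nonneg (by norm_num)
  refine ⟨Real.pi * A * Real.log 24 + Real.pi ^ 2 / 4 + Real.pi * A * |Real.log K|, by positivity, fun M => ?_⟩
  have h1 : Real.log ((M + 1) / K) ≤ (M + 1) / K - 1 := Real.log_le_sub_one_of_pos (by positivity)
  rw [Real.log_div (by positivity) hK0.ne'] at h1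
  have h2 : Real.log (M + 1) ≤ (M + 1) / K + |Real.log K| := by linarith [le_abs_self (Real.log K)]
  have h3 : A / K ≤ Real.pi / 4 := by
    rw [div_le_div_iff₀ hK0 (by norm_num)]
    rw [hK, mul_add, mul_one]
    have : Real.pi * (4 * A / Real.pi) = 4 * A := by field_simp
    linarith
  have h4 : Real.pi * A * ((M + 1) / K) ≤ Real.pi ^ 2 / 4 * (M + 1) := by
    calc Real.pi * A * ((M + 1) / K) = Real.pi * (A / K) * (M + 1) := by ring
      _ ≤ Real.pi * (Real.pi / 4) * (M + 1) := by gcongr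
      _ = _ := by ring
  have h5 := mul_le_mul_of_nonneg_left h2 (by positivity : 0 ≤ Real.pi * A)
  nlinarith

lemma energy_ball : ∃ C : ℤ → ℝ, (∀ D, 0 ≤ C D) ∧
    ∀ (Ω : Set Plane) (_ : Bornology.IsBounded Ω) (ε : ℝ) (_ : 0 < ε)
    (u : ℤ × ℤ → ℝ) (N : ℕ) (d : Fin N → ℤ) (x : Fin N → Plane) (h : Fin N) (σ : ℝ) (_ : 0 < σ)
    (_ : ball (x h) σ ⊆ Ω) (_ : ∀ h', h' ≠ h → σ ≤ dist (x h') (x h))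
    (_ : 16 * ε ≤ σ)
    (_ : flatNorm Ω (fun p => vortMeas ε u Ω p - ∑ h, if x h = p then (d h : ℝ) else 0)
      < min 1 (σ / 4)),
    ENNReal.ofReal (Real.pi * |(d h : ℝ)| * Real.log (σ / ε) - C (d h)) ≤ Fedge ε u (ball (x h) σ) := by
  choose C hC0 hC using fun D : ℤ => log_absorb |(D : ℝ)| (abs_nonneg _)
  refine ⟨C, hC0, ?_⟩
  intro Ω h1 ε hε u N d x h σ hσ h2 h3 h4 h5
  obtain ⟨M, hM⟩ := main_ball Ω h1 ε hε u N d x h σ hσ h2 h3 h4 h5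
  refine le_trans (ENNReal.ofReal_le_ofReal ?_) (Fedge_ge ε hε u (x h) σ)
  have h6 := hC (d h) M
  have hpi := Real.pi_pos
  have h7 := mul_le_mul_of_nonneg_left hM (by positivity : 0 ≤ 2 * Real.pi ^ 2)
  refine le_trans ?_ h7
  rw [Real.log_div (x := σ / ε) (y := 24 * ((M : ℝ) + 1)) (by positivity) (by positivity),
    Real.log_mul (by norm_num) (by positivity)]
  have h8 : 2 * Real.pi ^ 2 * ((M : ℝ) / 8 + 1 / (2 * Real.pi) *
      (Real.log (σ / ε) - (Real.log 24 + Real.log (M + 1))) * |(d h : ℝ)|) =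
      Real.pi ^ 2 / 4 * M + Real.pi * |(d h : ℝ)| * Real.log (σ / ε)
      - Real.pi * |(d h : ℝ)| * (Real.log 24 + Real.log (M + 1)) := by
    field_simp
    ring
  rw [h8]
  linarith

lemma tsum_sup {N : ℕ} (A : Fin N → Set (ℤ × ℤ)) (B : Set (ℤ × ℤ)) (hAB : ∀ h, A h ⊆ B)
    (hdis : ∀ h h', h ≠ h' → Disjoint (A h) (A h')) (g : ℤ × ℤ → ℝ≥0∞) :
    ∑ h, ∑' i : A h, g i ≤ ∑' i : B, g i := by
  simp only [tsum_subtype]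
  rw [← Summable.tsum_finsetSum fun _ _ => ENNReal.summable]
  refine ENNReal.tsum_le_tsum fun i => ?_
  by_cases hi : ∃ h, i ∈ A h
  · obtain ⟨h, hh⟩ := hi
    rw [Finset.sum_eq_single h, Set.indicator_of_mem hh, Set.indicator_of_mem (hAB h hh)]
    · intro k _ hk
      exact Set.indicator_of_notMem (fun hc => Set.disjoint_left.1 (hdis k h hk) hc hh) _
    · simp
  · push Not at hi
    rw [Finset.sum_eq_zero fun h _ => Set.indicator_of_notMem (hi h) _]
    exact zero_le

lemma Fedge_super {N : ℕ} (ε : ℝ) (u : ℤ × ℤ → ℝ) (A : Fin N → Set Plane) (B : Set Plane)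
    (hAB : ∀ h, A h ⊆ B) (hdis : ∀ h h', h ≠ h' → Disjoint (A h) (A h')) :
    ∑ h, Fedge ε u (A h) ≤ Fedge ε u B := by
  simp only [Fedge]
  rw [Finset.sum_add_distrib]
  have key : ∀ e : ℤ × ℤ, ∀ h h', h ≠ h' → Disjoint (latticeSeg ε e (A h)) (latticeSeg ε e (A h')) := by
    intro e h h' hh
    rw [Set.disjoint_left]
    intro i hi hi'
    exact Set.disjoint_left.1 (hdis h h' hh) (hi (left_mem_segment _ _ _)) (hi' (left_mem_segment _ _ _))
  exact add_le_add
    (tsum_sup (fun h => latticeSeg ε (1,0) (A h)) _ (fun h i hi => hi.trans (hAB h)) (key _)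
      (fun i => ENNReal.ofReal (f0 (u (i + (1,0)) - u i))))
    (tsum_sup (fun h => latticeSeg ε (0,1) (A h)) _ (fun h i hi => hi.trans (hAB h)) (key _)
      (fun i => ENNReal.ofReal (f1 (u (i + (0,1)) - u i))))

lemma exists_sigma (Ω : Set Plane) (hΩo : IsOpen Ω) (N : ℕ) (x : Fin N → Plane)
    (hxinj : Function.Injective x) (hxΩ : ∀ h, x h ∈ Ω) :
    ∃ σ : ℝ, 0 < σ ∧ (∀ h, ball (x h) σ ⊆ Ω) ∧
      (∀ h h', h ≠ h' → Disjoint (ball (x h) σ) (ball (x h') σ)) := by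
  have h1 : ∀ h, ∀ᶠ σ in nhdsWithin (0:ℝ) (Set.Ioi 0), ball (x h) σ ⊆ Ω := by
    intro h
    obtain ⟨r, hr, hrb⟩ := Metric.isOpen_iff.1 hΩo (x h) (hxΩ h)
    filter_upwards [Ioo_mem_nhdsGT hr] with σ hσ
    exact (ball_subset_ball hσ.2.le).trans hrb
  have h2 : ∀ h h', ∀ᶠ σ in nhdsWithin (0:ℝ) (Set.Ioi 0),
      h ≠ h' → Disjoint (ball (x h) σ) (ball (x h') σ) := by
    intro h h'
    by_cases hh : h = h'
    · simp [hh]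
    · have hd : 0 < dist (x h) (x h') / 2 := by
        have := dist_pos.2 (hxinj.ne hh)
        positivity
      filter_upwards [Ioo_mem_nhdsGT hd] with σ hσ _
      refine ball_disjoint_ball ?_
      linarith [hσ.2]
  obtain ⟨σ, a, b, c⟩ := ((eventually_mem_nhdsWithin (a := (0:ℝ)) (s := Set.Ioi 0)).and
    ((Filter.eventually_all.2 h1).and (Filter.eventually_all.2 fun h => Filter.eventually_all.2 (h2 h)))).exists
  exact ⟨σ, a, b, c⟩

lemma ofReal_sum_le' {N : ℕ} (g : Fin N → ℝ) : ENNReal.ofReal (∑ h, g h) ≤ ∑ h, ENNReal.ofReal (g h) := by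
  refine Finset.le_sum_of_subadditive ENNReal.ofReal (by simp) (fun a b => ENNReal.ofReal_add_le) _ _

end Helpers

/-- Lower bound, zero order: if the restricted vorticity measures of `u_n`
converge flat to `μ = Σ_{h<N} d_h δ_{x_h} ∈ X(Ω)`, then there is `C̄ ∈ ℝ` such that for every
admissible `σ > 0` and every `h`,
`liminf_n (F_{ε_n}^{edge}(u_n,B_σ(x_h)) − π|d_h| log(σ/ε_n)) ≥ C̄`;
in particular `liminf_n (1/|log ε_n|)·F_{ε_n}^{edge}(u_n,Ω) ≥ π|μ|(Ω)`. -/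
theorem stmt14 (Ω : Set Plane) (hΩo : IsOpen Ω) (hΩb : Bornology.IsBounded Ω)
    (hΩl : HasLipschitzBoundary Ω)
    (ε : ℕ → ℝ) (hε : ∀ n, ε n ∈ Set.Ioo (0 : ℝ) 1)
    (hε0 : Filter.Tendsto ε Filter.atTop (nhds 0))
    (u : ℕ → ℤ × ℤ → ℝ)
    (N : ℕ) (d : Fin N → ℤ) (x : Fin N → Plane)
    (hd : ∀ h, d h ≠ 0) (hxinj : Function.Injective x) (hxΩ : ∀ h, x h ∈ Ω)
    (hflat : Filter.Tendsto
      (fun n => flatNorm Ω (fun p =>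
        vortMeas (ε n) (u n) Ω p - ∑ h, if x h = p then (d h : ℝ) else 0))
      Filter.atTop (nhds 0)) :
    (∃ Cbar : ℝ,
        ∀ σ : ℝ, 0 < σ → (∀ h, Metric.ball (x h) σ ⊆ Ω) →
          (∀ h h', h ≠ h' → Disjoint (Metric.ball (x h) σ) (Metric.ball (x h') σ)) →
          ∀ h, (Cbar : EReal) ≤
            Filter.liminf
              (fun n => ENNReal.toEReal (Fedge (ε n) (u n) (Metric.ball (x h) σ))
                - ((Real.pi * |(d h : ℝ)| * Real.log (σ / ε n) : ℝ) : EReal))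
              Filter.atTop) ∧
      ENNReal.ofReal (Real.pi * ∑ h, |(d h : ℝ)|) ≤
        Filter.liminf (fun n => ENNReal.ofReal (1 / |Real.log (ε n)|) * Fedge (ε n) (u n) Ω)
          Filter.atTop := by

  have _ := hd
  have _ := hΩl
  obtain ⟨C, hC0, hC⟩ := energy_ball
  have hout : ∀ σ : ℝ, 0 < σ → (∀ h h', h ≠ h' → Disjoint (Metric.ball (x h) σ) (Metric.ball (x h') σ)) →
      ∀ h h', h' ≠ h → σ ≤ dist (x h') (x h) := by
    intro σ hσ hdis h h' hh
    by_contra hcon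
    push Not at hcon
    exact Set.disjoint_left.1 (hdis h h' hh.symm) (Metric.mem_ball.2 hcon) (Metric.mem_ball_self hσ)
  have hev : ∀ σ : ℝ, 0 < σ → (∀ h, Metric.ball (x h) σ ⊆ Ω) →
      (∀ h h', h ≠ h' → Disjoint (Metric.ball (x h) σ) (Metric.ball (x h') σ)) →
      ∀ᶠ n in Filter.atTop, ∀ h,
        ENNReal.ofReal (Real.pi * |(d h : ℝ)| * Real.log (σ / ε n) - C (d h))
          ≤ Fedge (ε n) (u n) (Metric.ball (x h) σ) := by
    intro σ hσ hb hdis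
    have e1 : ∀ᶠ n in Filter.atTop, ε n < σ / 16 := hε0.eventually_lt_const (by positivity)
    have e2 := hflat.eventually_lt_const (lt_min one_pos (by positivity) : (0:ℝ) < min 1 (σ / 4))
    filter_upwards [e1, e2] with n h1 h2 h
    exact hC Ω hΩb (ε n) (hε n).1 (u n) N d x h σ hσ (hb h) (hout σ hσ hdis h) (by linarith) h2
  constructor
  · refine ⟨- ∑ h, C (d h), ?_⟩
    intro σ hσ hb hdis h
    refine Filter.le_liminf_of_le (by isBoundedDefault) ?_
    filter_upwards [hev σ hσ hb hdis] with n hn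
    have h1 := hn h
    have h2 : C (d h) ≤ ∑ h, C (d h) :=
      Finset.single_le_sum (f := fun h => C (d h)) (fun k _ => hC0 _) (Finset.mem_univ h)
    set F := Fedge (ε n) (u n) (Metric.ball (x h) σ)
    set a := Real.pi * |(d h : ℝ)| * Real.log (σ / ε n)
    by_cases hF : F = ⊤
    · rw [hF]
      simp
    · have h3 : a - C (d h) ≤ F.toReal := by
        rw [ENNReal.ofReal_le_iff_le_toReal hF] at h1
        exact h1
      have h4 : ENNReal.toEReal F = ((F.toReal : ℝ) : EReal) := by
        exact (EReal.coe_ennreal_toReal hF).symm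
      rw [h4, ← EReal.coe_sub, EReal.coe_le_coe_iff]
      linarith
  · obtain ⟨σ, hσ, hb, hdis⟩ := exists_sigma Ω hΩo N x hxinj hxΩ
    set D := ∑ h, |(d h : ℝ)| with hD
    set G := ∑ h, C (d h) with hG
    have hlog : Filter.Tendsto (fun n => |Real.log (ε n)|) Filter.atTop Filter.atTop := by
      refine Filter.tendsto_abs_atBot_atTop.comp (Real.tendsto_log_nhdsGT_zero.comp ?_)
      exact tendsto_nhdsWithin_iff.2 ⟨hε0, Filter.Eventually.of_forall fun n => (hε n).1⟩
    have hlim : Filter.Tendsto (fun n => ENNReal.ofReal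
        (Real.pi * D + (Real.pi * D * Real.log σ - G) / |Real.log (ε n)|)) Filter.atTop
        (nhds (ENNReal.ofReal (Real.pi * D))) := by
      refine (ENNReal.continuous_ofReal.tendsto _).comp ?_
      simpa using (hlog.const_div_atTop (Real.pi * D * Real.log σ - G)).const_add (Real.pi * D)
    rw [← hlim.liminf_eq]
    refine Filter.liminf_le_liminf ?_
    filter_upwards [hev σ hσ hb hdis] with n hn
    have hen := hε n
    have hneg : Real.log (ε n) < 0 := Real.log_neg hen.1 hen.2
    have h1 : ENNReal.ofReal (Real.pi * D * Real.log (σ / ε n) - G) ≤ Fedge (ε n) (u n) Ω := by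
      refine le_trans ?_ (Fedge_super (ε n) (u n) (fun h => Metric.ball (x h) σ) Ω hb hdis)
      refine le_trans ?_ (Finset.sum_le_sum fun h _ => hn h)
      refine le_trans (le_of_eq ?_) (ofReal_sum_le' _)
      rw [Finset.sum_sub_distrib, ← Finset.sum_mul, ← Finset.mul_sum]
    refine le_trans (le_of_eq ?_) (mul_le_mul_right h1 _)
    rw [← ENNReal.ofReal_mul (by positivity), Real.log_div hσ.ne' hen.1.ne', abs_of_neg hneg]
    congr 1
    have hne : Real.log (ε n) ≠ 0 := hneg.ne
    field_simp
    ring
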